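/- Let a, b be odd integers greater than 1 with gcd(a,b) = 1 and max(a,b) ≥ 9, and let c > 1 be an even integer. Set α = min(ν₂(a² − 1) − 1, ν₂(b² − 1) − 1) (note α ≥ 2 automatically) and β = ν₂(c). Define m₂ = 1 if min(a,b) > 7 and m₂ = log 8 / log(min(a,b)) otherwise; m₃ = α·log 2 / log(2^α − 1); v_a = 3α·log 2 − log(3α·log 2); and log_*(t) = max(1, log t). If α = 2, set (k₁,k₂,k₃) = (1803.3·m₂/β, 23.865·m₂/β, 143.75·(m₂+1)/β); if α ≥ 3, set (k₁,k₂,k₃) = (2705·m₃/(α·β), 156.39·m₃·(1 + log(v_a)/(v_a − 1))²/(α³·β), 646.9·(m₃+1)/(α²·β)). Then every solution (x,y,z) of a^x + b^y = c^z in positive integers with z > 1 satisfies z < log(a)·log(b)·max( k₁, k₂·(log_*(k₃·log c))² ). -/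

import Mathlib

open Finset in
/-- Distinct weights below `n` force a total weight of at least `0 + 1 + ⋯ + (n - 1)`. -/
theorem sum_range_card_le_sum_of_injOn {ι : Type*} [DecidableEq ι] (s : Finset ι) (f : ι → ℕ)
    (hf : Set.InjOn f {i | i ∈ s ∧ f i < #s}) :
    ∑ v ∈ range #s, v ≤ ∑ i ∈ s, f i := by
  have h1 : ∀ i ∈ s, #{v ∈ range #s | v < f i} ≤ f i := by
    intro i _
    calc #{v ∈ range #s | v < f i} ≤ #(range (f i)) := by
          apply card_le_card
          intro v hv
          simp at hv ⊢
          exact hv.2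
      _ = f i := card_range _
  have h2 : ∀ v ∈ range #s, #s - (v + 1) ≤ #{i ∈ s | v < f i} := by
    intro v hv
    have hv' : v < #s := by simpa using hv
    have h3 : #{i ∈ s | ¬ v < f i} ≤ v + 1 := by
      rw [← card_range (v + 1)]
      apply card_le_card_of_injOn f
      · intro i hi
        simp at hi ⊢
        omega
      · intro i hi j hj hij
        simp at hi hj
        exact hf ⟨hi.1, by omega⟩ ⟨hj.1, by omega⟩ hij
    have h4 := card_filter_add_card_filter_not (s := s) (fun i => v < f i)
    omega
  calc ∑ v ∈ range #s, v = ∑ v ∈ range #s, (#s - (v + 1)) := by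
        rw [← sum_range_reflect]
        apply sum_congr rfl
        intro v _
        omega
    _ ≤ ∑ v ∈ range #s, #{i ∈ s | v < f i} := sum_le_sum h2
    _ = ∑ i ∈ s, #{v ∈ range #s | v < f i} := by
        simp only [card_filter]
        exact sum_comm
    _ ≤ ∑ i ∈ s, f i := sum_le_sum h1

open Finset in
/-- Divisibility of a determinant whose rows are combinations of weighted vectors. -/
theorem Matrix.pow_dvd_det_mul_of_weights {ι τ R : Type*} [Fintype ι] [DecidableEq ι] [Fintype τ]
    [CommRing R] (d : R) (k : ι → ℕ) (ω : τ → ℕ)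
    (hω : Set.InjOn ω {t | ω t < Fintype.card ι})
    (F : Matrix ι τ R) (C : Matrix τ ι R) (hF : ∀ i t, d ^ (ω t - k i) ∣ F i t) :
    d ^ (∑ v ∈ range (Fintype.card ι), v - ∑ i, k i) ∣ (F * C).det := by
  classical
  have h1 : (F * C).det = ∑ φ : ι → τ, (∏ i, F i (φ i)) * Matrix.det (fun i => C (φ i)) := by
    have : (F * C) = fun i => ∑ t, F i t • C t := by
      ext i j
      simp [Matrix.mul_apply, Finset.sum_apply]
    rw [this]
    change Matrix.detRowAlternating (fun i => ∑ t, F i t • C t) = _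
    have h2 := (Matrix.detRowAlternating (R := R) (n := ι)).toMultilinearMap.map_sum
      (fun i t => F i t • C t)
    refine h2.trans ?_
    apply sum_congr rfl
    intro φ _
    have h3 := (Matrix.detRowAlternating (R := R) (n := ι)).toMultilinearMap.map_smul_univ
      (fun i => F i (φ i)) (fun i => C (φ i))
    exact h3
  rw [h1]
  apply dvd_sum
  intro φ _
  by_cases hφ : Function.Injective φ
  · apply Dvd.dvd.mul_right
    have h4 : ∑ v ∈ range (Fintype.card ι), v ≤ ∑ i, ω (φ i) := by
      apply sum_range_card_le_sum_of_injOn univ (fun i => ω (φ i))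
      intro i hi j hj hij
      exact hφ (hω (by simpa using hi) (by simpa using hj) hij)
    have h5 : ∑ i, ω (φ i) ≤ ∑ i, (ω (φ i) - k i) + ∑ i, k i := by
      rw [← sum_add_distrib]
      exact sum_le_sum fun i _ => by omega
    refine (pow_dvd_pow d (by omega : _ ≤ ∑ i, (ω (φ i) - k i))).trans ?_
    rw [← prod_pow_eq_pow_sum]
    exact prod_dvd_prod_of_dvd _ _ fun i _ => hF i (φ i)
  · have : Matrix.det (fun i => C (φ i)) = 0 := by
      obtain ⟨i, j, hij, hne⟩ : ∃ i j, φ i = φ j ∧ i ≠ j := by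
        simpa [Function.Injective] using hφ
      exact Matrix.det_zero_of_row_eq hne (by simp [hij])
    rw [this, mul_zero]
    exact dvd_zero _

open Finset in
theorem choose_mul_one_add_pow {R : Type*} [CommRing R] (h : R) (k w T : ℕ) (hT : w < T) :
    (w.choose k : R) * (1 + h) ^ w =
      ∑ t ∈ range T, (if k ≤ t then (1 + h) ^ k * (t.choose k : R) * h ^ (t - k) else 0) *
        (w.choose t : R) := by
  by_cases hk : k ≤ w
  · obtain ⟨m, rfl⟩ := Nat.exists_eq_add_of_le hk
    obtain ⟨T', rfl⟩ := Nat.exists_eq_add_of_le (show k + m + 1 ≤ T by omega)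
    have hs : ∀ f : ℕ → R, ∑ t ∈ range (k + m + 1 + T'), (if k ≤ t then f t else 0) *
        ((k + m).choose t : R) = ∑ t ∈ range (m + 1), f (k + t) * ((k + m).choose (k + t) : R) := by
      intro f
      rw [sum_range_add, add_assoc, sum_range_add]
      rw [sum_eq_zero, zero_add, add_eq_left.mpr]
      · simp
      · apply sum_eq_zero
        intro t _
        rw [Nat.choose_eq_zero_of_lt (by omega)]
        simp
      · intro t ht
        have : ¬ k ≤ t := by simpa using ht
        simp [this]
    rw [hs, pow_add, add_comm 1 h, add_pow h 1 m, mul_left_comm, mul_sum, mul_sum]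
    apply sum_congr rfl
    intro t ht
    have ht' : t ≤ m := by simpa [Nat.lt_succ_iff] using ht
    have := Nat.choose_mul (n := k + m) (k := k + t) (s := k) (by omega)
    simp only [Nat.add_sub_cancel_left] at this
    have h6 : ((k + m).choose (k + t) : R) * ((k + t).choose k : R) =
      ((k + m).choose k : R) * (m.choose t : R) := by
      rw [← Nat.cast_mul, ← Nat.cast_mul, this]
    simp only [Nat.add_sub_cancel_left, one_pow, mul_one]
    linear_combination (-(h + 1) ^ k * h ^ t) * h6
  · rw [Nat.choose_eq_zero_of_lt (by omega)]
    simp only [Nat.cast_zero, zero_mul]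
    symm
    apply sum_eq_zero
    intro t _
    split_ifs with h
    · rw [Nat.choose_eq_zero_of_lt (show w < t by omega)]
      simp
    · simp

theorem Matrix.exists_det_ne_zero_of_forall_dotProduct {ι κ 𝕜 : Type*} [Fintype ι] [DecidableEq ι]
    [Field 𝕜] (v : κ → ι → 𝕜) (hv : ∀ c : ι → 𝕜, (∀ j, ∑ i, c i * v j i = 0) → c = 0) :
    ∃ p : ι → κ, Function.Injective p ∧ Matrix.det (Matrix.of fun i j => v (p j) i) ≠ 0 := by
  have hspan : Submodule.span 𝕜 (Set.range v) = ⊤ := by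
    by_contra hne
    obtain ⟨f, hf0, hf⟩ := Submodule.exists_le_ker_of_lt_top _ (lt_top_iff_ne_top.mpr hne)
    apply hf0
    have h0 : (fun i => f (Pi.single i 1)) = 0 := by
      apply hv
      intro j
      have h1 : f (v j) = 0 := hf (Submodule.subset_span ⟨j, rfl⟩)
      rw [← h1]
      conv_rhs => rw [pi_eq_sum_univ' (v j), map_sum]
      apply Finset.sum_congr rfl
      intro i _
      rw [map_smul, smul_eq_mul, mul_comm]
    apply LinearMap.pi_ext'
    intro i
    ext
    simpa using congrFun h0 i
  obtain ⟨μ, a, ha, hs, hli⟩ := exists_linearIndependent' 𝕜 v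
  rw [hspan] at hs
  let bas := Module.Basis.mk hli hs.ge
  let e : ι ≃ μ := (Pi.basisFun 𝕜 ι).indexEquiv bas
  refine ⟨a ∘ e, ha.comp e.injective, ?_⟩
  have h2 : LinearIndependent 𝕜 (fun j => v (a (e j))) := hli.comp e e.injective
  have h3 := Matrix.linearIndependent_rows_iff_isUnit (A := Matrix.of fun j i => v (a (e j)) i)
  have h4 := h3.mp h2
  rw [Matrix.isUnit_iff_isUnit_det, isUnit_iff_ne_zero] at h4
  rw [← Matrix.det_transpose]
  exact h4

open Finset Polynomial in
/-- An exponential polynomial in two variables with too many zeros on a sumset vanishes. -/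
theorem Polynomial.eq_zero_of_sum_pow_mul_eval_eq_zero {𝕜 J₁ J₂ : Type*} [Field 𝕜]
    [Fintype J₁] [Fintype J₂] {L D : ℕ} (P : Fin L → 𝕜[X]) (hP : ∀ l, (P l).natDegree ≤ D)
    (w₁ θ₁ : J₁ → 𝕜) (w₂ θ₂ : J₂ → 𝕜) (hθ₁ : Function.Injective θ₁)
    (hL : L ≤ Fintype.card J₁) (hw₂ : Function.Injective w₂) (hθ₂ : ∀ j, θ₂ j ≠ 0)
    (hD : L * D < Fintype.card J₂)
    (h : ∀ i j, ∑ l : Fin L, (θ₁ i * θ₂ j) ^ (l : ℕ) * (P l).eval (w₁ i + w₂ j) = 0) :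
    ∀ l, P l = 0 := by
  classical
  by_contra hne
  push Not at hne
  obtain ⟨l₀, hl₀⟩ := hne
  let Λ := {l : Fin L // P l ≠ 0}
  obtain ⟨p, -, hp⟩ := Matrix.exists_det_ne_zero_of_forall_dotProduct
    (fun (j : J₁) (l : Λ) => θ₁ j ^ ((l : Fin L) : ℕ)) (by
      intro c hc
      let Q : 𝕜[X] := ∑ l : Λ, C (c l) * X ^ ((l : Fin L) : ℕ)
      have hQ : Q = 0 := by
        apply Polynomial.eq_zero_of_natDegree_lt_card_of_eval_eq_zero Q hθ₁
        · intro i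
          simpa [Q, eval_finsetSum] using hc i
        · refine lt_of_lt_of_le ?_ hL
          have : Q.natDegree ≤ L - 1 := by
            apply natDegree_sum_le_of_forall_le
            intro l _
            refine (natDegree_C_mul_X_pow_le _ _).trans ?_
            have := (l : Fin L).2
            omega
          have := l₀.2
          omega
      ext l
      have h1 : Q.coeff ((l : Fin L) : ℕ) = 0 := by rw [hQ, coeff_zero]
      simp only [Q, finsetSum_coeff, coeff_C_mul, coeff_X_pow] at h1
      rw [sum_eq_single l] at h1
      · simpa using h1
      · intro m _ hm
        rw [if_neg, mul_zero]
        intro h2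
        exact hm (Subtype.ext (Fin.ext h2.symm))
      · simp)
  let E : Matrix Λ Λ 𝕜[X] := Matrix.of fun l i =>
    C (θ₁ (p i) ^ ((l : Fin L) : ℕ)) * (X ^ (D - (P l).natDegree) * (P l).comp (X + C (w₁ (p i))))
  have hEdeg : ∀ l i, (E l i).natDegree ≤ D := by
    intro l i
    simp only [E, Matrix.of_apply]
    refine (natDegree_C_mul_le _ _).trans (natDegree_mul_le.trans ?_)
    rw [natDegree_X_pow, natDegree_comp, natDegree_X_add_C, mul_one]
    have := hP l
    omega
  have hEcoeff : ∀ l i, (E l i).coeff D = θ₁ (p i) ^ ((l : Fin L) : ℕ) * (P l).leadingCoeff := by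
    intro l i
    simp only [E, Matrix.of_apply]
    rw [coeff_C_mul, mul_comm (X ^ _), coeff_mul_X_pow', if_pos (Nat.sub_le _ _),
      Nat.sub_sub_self (hP l)]
    congr 1
    have h1 : ((P l).comp (X + C (w₁ (p i)))).natDegree = (P l).natDegree := by
      rw [natDegree_comp, natDegree_X_add_C, mul_one]
    have h2 := leadingCoeff_comp (p := P l) (q := X + C (w₁ (p i)))
      (by rw [natDegree_X_add_C]; exact one_ne_zero)
    rw [leadingCoeff, h1] at h2
    simpa using h2
  have hdetcoeff : E.det.coeff (#(univ : Finset Λ) * D) ≠ 0 := by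
    have h1 : E.det.coeff (#(univ : Finset Λ) * D) = (Matrix.of fun l i => (E l i).coeff D).det := by
      rw [Matrix.det_apply, Matrix.det_apply, finsetSum_coeff]
      apply sum_congr rfl
      intro σ _
      rw [coeff_smul, coeff_prod_of_natDegree_le _ _ _ fun i _ => hEdeg _ _]
      rfl
    have h2 : (Matrix.of fun l i => (E l i).coeff D) =
        Matrix.diagonal (fun l : Λ => (P l).leadingCoeff) *
          Matrix.of fun (l i : Λ) => θ₁ (p i) ^ ((l : Fin L) : ℕ) := by
      ext l i
      simp only [Matrix.diagonal_mul, Matrix.of_apply]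
      rw [hEcoeff, mul_comm]
    rw [h1, h2, Matrix.det_mul, Matrix.det_diagonal]
    exact mul_ne_zero (prod_ne_zero_iff.mpr fun l _ => leadingCoeff_ne_zero.mpr l.2) hp
  apply hdetcoeff
  have hdet : E.det = 0 := by
    apply Polynomial.eq_zero_of_natDegree_lt_card_of_eval_eq_zero _ hw₂
    · intro j
      have h1 : (evalRingHom (w₂ j)) E.det = ((evalRingHom (w₂ j)).mapMatrix E).det :=
        RingHom.map_det _ _
      change (evalRingHom (w₂ j)) E.det = 0
      rw [h1]
      by_cases hw : w₂ j = 0 ∧ ∃ l : Λ, D - (P l).natDegree ≠ 0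
      · obtain ⟨hw, l, hl⟩ := hw
        apply Matrix.det_eq_zero_of_row_eq_zero l
        intro i
        simp [E, hw, hl]
      · have hx : ∀ l : Λ, w₂ j ^ (D - (P l).natDegree) ≠ 0 := by
          intro l
          by_cases hw0 : w₂ j = 0
          · have : D - (P l).natDegree = 0 := by
              by_contra h2
              exact hw ⟨hw0, l, h2⟩
            rw [this, pow_zero]
            exact one_ne_zero
          · exact pow_ne_zero _ hw0
        by_contra hdet
        have h2 : (fun l : Λ => θ₂ j ^ ((l : Fin L) : ℕ) / w₂ j ^ (D - (P l).natDegree)) = 0 := by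
          apply Matrix.eq_zero_of_vecMul_eq_zero hdet
          ext i
          rw [Pi.zero_apply, ← h (p i) j, Matrix.vecMul, dotProduct]
          rw [← sum_subset (subset_univ ({l : Fin L | P l ≠ 0} : Finset (Fin L)))
            (by intro l _ hl; simp at hl; simp [hl])]
          rw [sum_subtype (p := fun l => P l ≠ 0) _ (by simp)]
          apply sum_congr rfl
          intro l _
          have := hx l
          simp only [E, RingHom.mapMatrix_apply, Matrix.map_apply, Matrix.of_apply,
            coe_evalRingHom, eval_mul, eval_C, eval_pow, eval_X, eval_comp, eval_add]
          field_simp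
          rw [mul_pow, add_comm (w₂ j)]
          ring
        have h3 := congrFun h2 ⟨l₀, hl₀⟩
        simp only [Pi.zero_apply] at h3
        exact div_ne_zero (pow_ne_zero _ (hθ₂ j)) (hx ⟨l₀, hl₀⟩) h3
    · refine lt_of_le_of_lt ?_ hD
      have h1 : E.det.natDegree ≤ #(univ : Finset Λ) * D := by
        rw [Matrix.det_apply]
        apply natDegree_sum_le_of_forall_le
        intro σ _
        refine (natDegree_smul_le _ _).trans ((natDegree_prod_le _ _).trans ?_)
        rw [← smul_eq_mul]
        exact sum_le_card_nsmul _ _ _ fun i _ => hEdeg _ _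
      refine h1.trans (Nat.mul_le_mul_right _ ?_)
      rw [card_univ]
      exact (Fintype.card_subtype_le (fun l : Fin L => P l ≠ 0)).trans_eq (Fintype.card_fin L)
  rw [hdet, coeff_zero]

theorem Int.pow_mul_pow_injective {a b : ℤ} (ha : 1 < a.natAbs) (hb : 1 < b.natAbs)
    (hab : IsCoprime a b) : Function.Injective fun p : ℕ × ℕ => a ^ p.1 * b ^ p.2 := by
  have key : ∀ r s r' s' : ℕ, r ≤ r' → a ^ r * b ^ s = a ^ r' * b ^ s' → r = r' ∧ s = s' := by
    intro r s r' s' hr h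
    obtain ⟨m, rfl⟩ := Nat.exists_eq_add_of_le hr
    have ha0 : a ≠ 0 := by rintro rfl; simp at ha
    rw [pow_add, mul_assoc] at h
    have h1 := mul_left_cancel₀ (pow_ne_zero r ha0) h
    rcases Nat.eq_zero_or_pos m with rfl | hm
    · rw [pow_zero, one_mul] at h1
      refine ⟨rfl, ?_⟩
      have h2 := congrArg Int.natAbs h1
      rw [Int.natAbs_pow, Int.natAbs_pow] at h2
      exact Nat.pow_right_injective hb h2
    · exfalso
      have h2 : a ^ m ∣ b ^ s := ⟨_, h1⟩
      have h3 : IsUnit (a ^ m) := (IsCoprime.pow hab).isUnit_of_dvd' dvd_rfl h2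
      rw [isUnit_pow_iff hm.ne', Int.isUnit_iff_natAbs_eq] at h3
      omega
  rintro ⟨r, s⟩ ⟨r', s'⟩ h
  rcases le_total r r' with hr | hr
  · obtain ⟨h1, h2⟩ := key r s r' s' hr h
    rw [h1, h2]
  · obtain ⟨h1, h2⟩ := key r' s' r s hr h.symm
    rw [h1, h2]

theorem Nat.mul_add_mul_injective_of_coprime {x y R S : ℕ} (hxy : x.Coprime y)
    (h : R ≤ x ∨ S ≤ y) :
    Function.Injective fun p : Fin R × Fin S => (p.1 : ℕ) * y + (p.2 : ℕ) * x := by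
  have key : ∀ (r s r' s' : ℕ), r < R → s < S → r' < R → s' < S → r ≤ r' →
      r * y + s * x = r' * y + s' * x → r = r' ∧ s = s' := by
    intro r s r' s' hr hs hr' hs' hle heq
    obtain ⟨m, rfl⟩ := Nat.exists_eq_add_of_le hle
    have h1 : s * x = m * y + s' * x := by linarith
    have h2 : s' ≤ s := by
      by_contra h3
      push Not at h3
      have hx : 0 < x := by
        rcases Nat.eq_zero_or_pos x with rfl | hx
        · have hy : y = 1 := by simpa using hxy
          subst hy
          omega
        · exact hx
      have := Nat.mul_lt_mul_of_pos_right h3 hx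
      omega
    obtain ⟨t, rfl⟩ := Nat.exists_eq_add_of_le h2
    have h4 : t * x = m * y := by linarith
    have h5 : x ∣ m := hxy.dvd_of_dvd_mul_right ⟨t, by rw [← h4, mul_comm]⟩
    have h6 : y ∣ t := hxy.symm.dvd_of_dvd_mul_right ⟨m, by rw [h4, mul_comm]⟩
    rcases h with h | h
    · have hm : m = 0 := Nat.eq_zero_of_dvd_of_lt h5 (by omega)
      subst hm
      rcases Nat.eq_zero_or_pos x with rfl | hx
      · omega
      · have : t = 0 := by
          rcases mul_eq_zero.mp (h4.trans (zero_mul y)) with h | h <;> omega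
        omega
    · have ht : t = 0 := Nat.eq_zero_of_dvd_of_lt h6 (by omega)
      subst ht
      rcases Nat.eq_zero_or_pos y with rfl | hy
      · omega
      · have : m = 0 := by
          rcases mul_eq_zero.mp (h4.symm.trans (zero_mul x)) with h | h <;> omega
        omega
  rintro ⟨r, s⟩ ⟨r', s'⟩ heq
  simp only at heq
  rcases le_total (r : ℕ) r' with hr | hr
  · obtain ⟨h1, h2⟩ := key r s r' s' r.2 s.2 r'.2 s'.2 hr heq
    rw [Fin.ext h1, Fin.ext h2]
  · obtain ⟨h1, h2⟩ := key r' s' r s r'.2 s'.2 r.2 s.2 hr heq.symm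
    rw [Fin.ext h1, Fin.ext h2]

open Finset Polynomial in
/-- The interpolation determinant of the functions `w.choose k * (a ^ r * b ^ s) ^ l`, where
`w = r * y + s * x`, is nonzero for a suitable choice of points `(r, s)`. -/
theorem exists_interpolation_det_ne_zero {a b : ℤ} (ha : 1 < a.natAbs) (hb : 1 < b.natAbs)
    (hab : IsCoprime a b) {x y : ℕ} (hxy : x.Coprime y) {K L R₁ S₁ R₂ S₂ : ℕ}
    (hL : L ≤ R₁ * S₁) (hK : L * (K - 1) < R₂ * S₂) (hRS : R₂ ≤ x ∨ S₂ ≤ y) :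
    ∃ p : Fin K × Fin L → Fin (R₁ + R₂ - 1) × Fin (S₁ + S₂ - 1), Function.Injective p ∧
      Matrix.det (Matrix.of fun (i j : Fin K × Fin L) =>
        ((((p j).1 : ℕ) * y + ((p j).2 : ℕ) * x).choose (i.1 : ℕ) : ℤ) *
          (a ^ ((p j).1 : ℕ) * b ^ ((p j).2 : ℕ)) ^ (i.2 : ℕ)) ≠ 0 := by
  have ha0 : a ≠ 0 := by rintro rfl; simp at ha
  have hb0 : b ≠ 0 := by rintro rfl; simp at hb
  obtain ⟨p, hp, hdet⟩ := Matrix.exists_det_ne_zero_of_forall_dotProduct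
    (fun (j : Fin (R₁ + R₂ - 1) × Fin (S₁ + S₂ - 1)) (i : Fin K × Fin L) =>
      (((j.1 : ℕ) * y + (j.2 : ℕ) * x).choose (i.1 : ℕ) : ℚ) *
        ((a : ℚ) ^ (j.1 : ℕ) * (b : ℚ) ^ (j.2 : ℕ)) ^ (i.2 : ℕ)) (by
    intro c hc
    let Q : ℕ → ℚ[X] := fun k => C ((k.factorial : ℚ)⁻¹) * descPochhammer ℚ k
    have hQ : ∀ k n : ℕ, (Q k).eval (n : ℚ) = (n.choose k : ℚ) := by
      intro k n
      have : (k.factorial : ℚ) ≠ 0 := by exact_mod_cast k.factorial_ne_zero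
      simp only [Q, eval_mul, eval_C]
      rw [descPochhammer_eval_eq_descFactorial, Nat.descFactorial_eq_factorial_mul_choose]
      push_cast
      field_simp
    let P : Fin L → ℚ[X] := fun l => ∑ k : Fin K, C (c (k, l)) * Q k
    have hP : ∀ l, P l = 0 := by
      apply Polynomial.eq_zero_of_sum_pow_mul_eval_eq_zero (D := K - 1)
        (J₁ := Fin R₁ × Fin S₁) (J₂ := Fin R₂ × Fin S₂) P
        (w₁ := fun j => (((j.1 : ℕ) * y + (j.2 : ℕ) * x : ℕ) : ℚ))
        (θ₁ := fun j => (a : ℚ) ^ (j.1 : ℕ) * (b : ℚ) ^ (j.2 : ℕ))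
        (w₂ := fun j => (((j.1 : ℕ) * y + (j.2 : ℕ) * x : ℕ) : ℚ))
        (θ₂ := fun j => (a : ℚ) ^ (j.1 : ℕ) * (b : ℚ) ^ (j.2 : ℕ))
      · intro l
        apply natDegree_sum_le_of_forall_le
        intro k _
        refine (natDegree_C_mul_le _ _).trans ((natDegree_C_mul_le _ _).trans ?_)
        rw [descPochhammer_natDegree]
        have := k.2
        omega
      · rintro ⟨r, s⟩ ⟨r', s'⟩ h
        have h1 : a ^ (r : ℕ) * b ^ (s : ℕ) = a ^ (r' : ℕ) * b ^ (s' : ℕ) := by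
          simp only at h
          exact_mod_cast h
        have h2 := Int.pow_mul_pow_injective ha hb hab (a₁ := ((r : ℕ), (s : ℕ)))
          (a₂ := ((r' : ℕ), (s' : ℕ))) h1
        simp only [Prod.mk.injEq] at h2
        rw [Fin.ext h2.1, Fin.ext h2.2]
      · simpa using hL
      · intro j j' h
        simp only [Nat.cast_inj] at h
        exact Nat.mul_add_mul_injective_of_coprime hxy hRS h
      · intro j
        have : (a : ℚ) ≠ 0 := by exact_mod_cast ha0
        have : (b : ℚ) ≠ 0 := by exact_mod_cast hb0
        positivity
      · simpa using hK
      · rintro ⟨r, s⟩ ⟨r', s'⟩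
        have h1 := hc (⟨r + r', by omega⟩, ⟨s + s', by omega⟩)
        rw [Fintype.sum_prod_type, sum_comm] at h1
        rw [← h1]
        apply sum_congr rfl
        intro l _
        simp only [P]
        rw [eval_finsetSum, mul_sum]
        apply sum_congr rfl
        intro k _
        rw [eval_mul, eval_C, ← Nat.cast_add, hQ]
        rw [show (r : ℕ) * y + (s : ℕ) * x + ((r' : ℕ) * y + (s' : ℕ) * x) =
          ((r : ℕ) + r') * y + ((s : ℕ) + s') * x by ring]
        rw [pow_add, pow_add, mul_mul_mul_comm]
        ring
    have hzero : ∀ l : Fin L, ∀ n : ℕ, ∀ hn : n < K, c (⟨n, hn⟩, l) = 0 := by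
      intro l n
      induction n using Nat.strong_induction_on with
      | _ n ih =>
        intro hn
        have h1 : (P l).eval (n : ℚ) = 0 := by rw [hP l, eval_zero]
        simp only [P] at h1
        rw [eval_finsetSum, sum_eq_single ⟨n, hn⟩] at h1
        · rw [eval_mul, eval_C, hQ] at h1
          simpa using h1
        · intro k _ hk
          rw [eval_mul, eval_C, hQ]
          rcases lt_trichotomy (k : ℕ) n with h | h | h
          · rw [ih k h k.2, zero_mul]
          · exact absurd (Fin.ext h) hk
          · rw [Nat.choose_eq_zero_of_lt h]
            simp
        · simp
    ext ⟨k, l⟩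
    exact hzero l k k.2)
  refine ⟨p, hp, ?_⟩
  intro h0
  apply hdet
  have h1 := congrArg (Int.castRingHom ℚ) h0
  rw [RingHom.map_det, map_zero] at h1
  rw [← h1]
  congr 1
  ext i j
  simp

theorem exists_common_root_of_pow_eq_pow {G : Type*} [CommGroup G] {u v : G} {x y : ℕ}
    (hxy : x.Coprime y) (h : u ^ x = v ^ y) :
    ∃ g : G, g ^ y = u ∧ g ^ x = v ∧ ∀ H : Subgroup G, u ∈ H → v ∈ H → g ∈ H := by
  have hb : (x : ℤ) * x.gcdA y + y * x.gcdB y = 1 := by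
    have := Nat.gcd_eq_gcd_ab x y
    rw [hxy] at this
    exact_mod_cast this.symm
  have h' : u ^ (x : ℤ) = v ^ (y : ℤ) := by exact_mod_cast h
  refine ⟨v ^ x.gcdA y * u ^ x.gcdB y, ?_, ?_, fun H hu hv =>
    H.mul_mem (H.zpow_mem hv _) (H.zpow_mem hu _)⟩
  · rw [← zpow_natCast, mul_zpow, ← zpow_mul, mul_comm (x.gcdA y), zpow_mul, ← h', ← zpow_mul,
      ← zpow_mul, ← zpow_add, mul_comm (x.gcdB y), hb, zpow_one]
  · rw [← zpow_natCast, mul_zpow, ← zpow_mul, ← zpow_mul, mul_comm (x.gcdB y), zpow_mul u, h',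
      ← zpow_mul, ← zpow_add, mul_comm (x.gcdA y), hb, zpow_one]

theorem Int.exists_common_root_of_two_pow_dvd {a b : ℤ} {x y α N : ℕ} (hα : α ≠ 0) (hαN : α ≤ N)
    (hxy : x.Coprime y) (ha : 2 ^ α ∣ a - 1) (hb : 2 ^ α ∣ b - 1) (h : 2 ^ N ∣ a ^ x - b ^ y) :
    ∃ g : ℤ, 2 ^ α ∣ g - 1 ∧ 2 ^ N ∣ g ^ y - a ∧ 2 ^ N ∣ g ^ x - b := by
  have hzero : ∀ (m : ℕ) (t : ℤ), (2 : ℤ) ^ m ∣ t ↔ ((t : ℤ) : ZMod (2 ^ m)) = 0 := by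
    intro m t
    rw [ZMod.intCast_zmod_eq_zero_iff_dvd]
    push_cast
    rfl
  have hcop : ∀ t : ℤ, 2 ^ α ∣ t - 1 → IsUnit (t : ZMod (2 ^ N)) := by
    intro t ht
    have h2 : (2 : ℤ) ∣ t - 1 := (dvd_pow_self 2 hα).trans ht
    have h3 : IsCoprime t (2 ^ N) := by
      apply IsCoprime.pow_right
      obtain ⟨c, hc⟩ := h2
      exact ⟨1, -c, by linarith⟩
    have h4 : ((t : ℤ) : ZMod (2 ^ N)) * (t : ZMod (2 ^ N))⁻¹ = 1 :=
      ZMod.coe_int_mul_inv_eq_one (by exact_mod_cast h3)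
    exact IsUnit.of_mul_eq_one _ h4
  obtain ⟨u, hu⟩ := hcop a ha
  obtain ⟨v, hv⟩ := hcop b hb
  have huv : u ^ x = v ^ y := by
    ext
    rw [Units.val_pow_eq_pow_val, Units.val_pow_eq_pow_val, hu, hv, ← sub_eq_zero]
    have := (hzero N _).mp h
    push_cast at this
    exact this
  obtain ⟨g, hgy, hgx, hgH⟩ := exists_common_root_of_pow_eq_pow hxy huv
  have : NeZero (2 ^ N) := ⟨by positivity⟩
  obtain ⟨G, hG⟩ := ZMod.intCast_surjective (g : ZMod (2 ^ N))
  have hdvd : (2 : ℕ) ^ α ∣ 2 ^ N := pow_dvd_pow 2 hαN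
  have hcast : ∀ (t : ℤ) (w : (ZMod (2 ^ N))ˣ), (w : ZMod (2 ^ N)) = t →
      (w ∈ (Units.map (ZMod.castHom hdvd (ZMod (2 ^ α))).toMonoidHom).ker ↔ 2 ^ α ∣ t - 1) := by
    intro t w hw
    rw [MonoidHom.mem_ker, hzero, Units.ext_iff]
    simp [hw, sub_eq_zero]
  refine ⟨G, ?_, ?_, ?_⟩
  · exact (hcast G g hG.symm).mp (hgH _ ((hcast a u hu).mpr ha) ((hcast b v hv).mpr hb))
  · rw [hzero]
    push_cast
    rw [hG, ← hu, ← hgy]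
    simp
  · rw [hzero]
    push_cast
    rw [hG, ← hv, ← hgx]
    simp

open Finset in
/-- High divisibility by `2` of interpolation determinants when `a ^ x` is close to `b ^ y`. -/
theorem two_pow_dvd_interpolation_det {a b : ℤ} {x y α N : ℕ} (hα : α ≠ 0)
    (hxy : x.Coprime y) (ha : 2 ^ α ∣ a - 1) (hb : 2 ^ α ∣ b - 1) (h : 2 ^ N ∣ a ^ x - b ^ y)
    {ι : Type*} [Fintype ι] [DecidableEq ι] [Nonempty ι] (hN : α * Fintype.card ι ≤ N)
    (k l r s : ι → ℕ) :
    (2 : ℤ) ^ (α * (∑ v ∈ range (Fintype.card ι), v - ∑ i, k i)) ∣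
      Matrix.det (Matrix.of fun i j =>
        ((r j * y + s j * x).choose (k i) : ℤ) * (a ^ r j * b ^ s j) ^ l i) := by
  have hαN : α ≤ N := le_trans (Nat.le_mul_of_pos_right _ Fintype.card_pos) hN
  obtain ⟨g, hg1, hga, hgb⟩ := Int.exists_common_root_of_two_pow_dvd hα hαN hxy ha hb h
  set n := Fintype.card ι with hn
  have hgl : ∀ i, (2 : ℤ) ^ α ∣ g ^ l i - 1 := fun i =>
    hg1.trans (by simpa using sub_dvd_pow_sub_pow g 1 (l i))
  have hclose : ∀ i j, ((2 : ℤ) ^ α) ^ n ∣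
      ((r j * y + s j * x).choose (k i) : ℤ) * (a ^ r j * b ^ s j) ^ l i -
      ((r j * y + s j * x).choose (k i) : ℤ) * (g ^ l i) ^ (r j * y + s j * x) := by
    intro i j
    rw [← mul_sub]
    apply Dvd.dvd.mul_left
    rw [← pow_mul]
    refine (pow_dvd_pow 2 hN).trans ?_
    have e1 : a ≡ g ^ y [ZMOD 2 ^ N] := Int.modEq_iff_dvd.mpr hga
    have e2 : b ≡ g ^ x [ZMOD 2 ^ N] := Int.modEq_iff_dvd.mpr hgb
    have e3 := (((e1.pow (r j)).mul (e2.pow (s j))).pow (l i)).symm.dvd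
    refine e3.trans (dvd_of_eq ?_)
    ring
  choose E hE using hclose
  obtain ⟨T, hT⟩ : ∃ T, ∀ j, r j * y + s j * x < T :=
    ⟨∑ j, (r j * y + s j * x) + 1, fun j => Nat.lt_succ_of_le
      (single_le_sum (f := fun j => r j * y + s j * x) (fun _ _ => Nat.zero_le _) (mem_univ j))⟩
  let F : Matrix ι (Fin T ⊕ ι) ℤ := Matrix.of fun i t => t.elim
    (fun (t : Fin T) => if k i ≤ t then (1 + (g ^ l i - 1)) ^ k i * ((t : ℕ).choose (k i) : ℤ) *
      (g ^ l i - 1) ^ ((t : ℕ) - k i) else 0)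
    (fun i' => if i = i' then (2 ^ α) ^ n else 0)
  let C : Matrix (Fin T ⊕ ι) ι ℤ := Matrix.of fun t j => t.elim
    (fun (t : Fin T) => ((r j * y + s j * x).choose t : ℤ)) (fun i' => E i' j)
  have hM : (Matrix.of fun i j =>
      ((r j * y + s j * x).choose (k i) : ℤ) * (a ^ r j * b ^ s j) ^ l i) = F * C := by
    ext i j
    rw [Matrix.mul_apply, Fintype.sum_sum_type]
    have h1 := choose_mul_one_add_pow (g ^ l i - 1) (k i) (r j * y + s j * x) T (hT j)
    rw [sum_range] at h1
    simp only [F, C, Matrix.of_apply, Sum.elim_inl, Sum.elim_inr]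
    rw [← h1]
    simp only [ite_mul, zero_mul, sum_ite_eq, mem_univ, if_true]
    rw [← hE i j]
    ring
  rw [hM, pow_mul]
  refine Matrix.pow_dvd_det_mul_of_weights (2 ^ α : ℤ) k (Sum.elim (fun t : Fin T => (t : ℕ)) fun _ => n)
    ?_ F C ?_
  · rintro (t | i) ht (t' | i') ht' heq
    · simpa [Fin.ext_iff] using heq
    · simp [hn] at ht'
    · simp [hn] at ht
    · simp [hn] at ht
  · rintro i (t | i')
    · simp only [F, Matrix.of_apply, Sum.elim_inl]
      split_ifs
      · exact Dvd.dvd.mul_left (pow_dvd_pow_of_dvd (hgl i) _) _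
      · exact dvd_zero _
    · simp only [F, Matrix.of_apply, Sum.elim_inr]
      split_ifs
      · exact pow_dvd_pow _ (Nat.sub_le _ _)
      · exact dvd_zero _

open Finset in
/-- Archimedean upper bound for a power of two dividing an interpolation determinant. -/
theorem two_pow_le_of_dvd_det {ι : Type*} [Fintype ι] [DecidableEq ι] {a b : ℤ} (ha : Odd a)
    (hb : Odd b) (w : ι → ι → ℤ) (l r s : ι → ℕ) (ω : ι → ℝ) (hw : ∀ i j, |(w i j : ℝ)| ≤ ω i)
    {Da Db : ℝ}
    (hDa : ∀ σ τ : Equiv.Perm ι,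
      (∑ i, (l (σ i) : ℝ) * r i) - ∑ i, (l (τ i) : ℝ) * r i ≤ Da)
    (hDb : ∀ σ τ : Equiv.Perm ι,
      (∑ i, (l (σ i) : ℝ) * s i) - ∑ i, (l (τ i) : ℝ) * s i ≤ Db)
    {V : ℕ} (hdet : Matrix.det (Matrix.of fun i j => w i j * (a ^ r j * b ^ s j) ^ l i) ≠ 0)
    (hV : 2 ^ V ∣ Matrix.det (Matrix.of fun i j => w i j * (a ^ r j * b ^ s j) ^ l i)) :
    (2 : ℝ) ^ V ≤ (Fintype.card ι).factorial * (∏ i, ω i) *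
      Real.exp (Da * Real.log |(a : ℝ)| + Db * Real.log |(b : ℝ)|) := by
  let ea : Equiv.Perm ι → ℕ := fun σ => ∑ i, l (σ i) * r i
  let eb : Equiv.Perm ι → ℕ := fun σ => ∑ i, l (σ i) * s i
  obtain ⟨σa, -, hσa⟩ := exists_min_image univ ea univ_nonempty
  obtain ⟨σb, -, hσb⟩ := exists_min_image univ eb univ_nonempty
  let D : ℤ := ∑ σ : Equiv.Perm ι, (Equiv.Perm.sign σ : ℤ) *
    ((∏ i, w (σ i) i) * (a ^ (ea σ - ea σa) * b ^ (eb σ - eb σb)))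
  have hD : Matrix.det (Matrix.of fun i j => w i j * (a ^ r j * b ^ s j) ^ l i) =
      a ^ ea σa * b ^ eb σb * D := by
    rw [Matrix.det_apply', mul_sum]
    refine sum_congr rfl fun σ _ => ?_
    have h1 : a ^ ea σ = a ^ ea σa * a ^ (ea σ - ea σa) := by
      rw [← pow_add, Nat.add_sub_cancel' (hσa σ (mem_univ _))]
    have h2 : b ^ eb σ = b ^ eb σb * b ^ (eb σ - eb σb) := by
      rw [← pow_add, Nat.add_sub_cancel' (hσb σ (mem_univ _))]
    have h3 : ∏ i, w (σ i) i * (a ^ r i * b ^ s i) ^ l (σ i) =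
        (∏ i, w (σ i) i) * (a ^ ea σ * b ^ eb σ) := by
      simp only [ea, eb, prod_mul_distrib, mul_pow, ← pow_mul, ← prod_pow_eq_pow_sum, mul_comm]
    simp only [Int.cast_id, Matrix.of_apply]
    rw [h3, h1, h2]
    ring
  have ha0 : a ≠ 0 := by rintro rfl; simp at ha
  have hb0 : b ≠ 0 := by rintro rfl; simp at hb
  have hD0 : D ≠ 0 := fun h => hdet (by rw [hD, h, mul_zero])
  have hVD : 2 ^ V ∣ D := by
    rw [hD] at hV
    refine IsCoprime.dvd_of_dvd_mul_left (IsCoprime.pow_left ?_) hV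
    exact (IsCoprime.pow_right (Int.isCoprime_two_left.mpr ha)).mul_right
      (IsCoprime.pow_right (Int.isCoprime_two_left.mpr hb))
  have hle : (2 : ℝ) ^ V ≤ |(D : ℝ)| := by
    have h1 := Int.le_of_dvd (abs_pos.mpr hD0) ((dvd_abs _ _).mpr hVD)
    exact_mod_cast h1
  refine hle.trans ?_
  have hexp : ∀ (c : ℤ) (hc : c ≠ 0) (m : ℕ) (B : ℝ), (m : ℝ) ≤ B →
      |(c : ℝ)| ^ m ≤ Real.exp (B * Real.log |(c : ℝ)|) := by
    intro c hc m B hm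
    have h1 : (1 : ℝ) ≤ |(c : ℝ)| := by exact_mod_cast Int.one_le_abs hc
    rw [← Real.exp_log (pow_pos (by linarith : 0 < |(c : ℝ)|) m), Real.log_pow]
    exact Real.exp_le_exp.mpr (mul_le_mul_of_nonneg_right hm (Real.log_nonneg h1))
  have hterm : ∀ σ : Equiv.Perm ι, |(((Equiv.Perm.sign σ : ℤ) *
      ((∏ i, w (σ i) i) * (a ^ (ea σ - ea σa) * b ^ (eb σ - eb σb))) : ℤ) : ℝ)| ≤
      (∏ i, ω i) * Real.exp (Da * Real.log |(a : ℝ)| + Db * Real.log |(b : ℝ)|) := by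
    intro σ
    push_cast
    have hs : |((Equiv.Perm.sign σ : ℤ) : ℝ)| = 1 := by
      rcases Int.units_eq_one_or (Equiv.Perm.sign σ) with h | h <;> simp [h]
    rw [abs_mul, hs, one_mul, abs_mul, abs_mul, abs_pow, abs_pow, Finset.abs_prod, Real.exp_add]
    have h1 : ∏ i, |(w (σ i) i : ℝ)| ≤ ∏ i, ω i := by
      rw [← Equiv.prod_comp σ ω]
      exact prod_le_prod (fun _ _ => abs_nonneg _) fun i _ => hw _ _
    refine mul_le_mul h1 (mul_le_mul (hexp a ha0 _ _ ?_) (hexp b hb0 _ _ ?_) (by positivity)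
      (by positivity)) (by positivity) ((prod_nonneg fun _ _ => abs_nonneg _).trans h1)
    · rw [Nat.cast_sub (hσa σ (mem_univ _))]
      simpa [ea] using hDa σ σa
    · rw [Nat.cast_sub (hσb σ (mem_univ _))]
      simpa [eb] using hDb σ σb
  calc |(D : ℝ)| ≤ ∑ σ : Equiv.Perm ι, |(((Equiv.Perm.sign σ : ℤ) *
      ((∏ i, w (σ i) i) * (a ^ (ea σ - ea σa) * b ^ (eb σ - eb σb))) : ℤ) : ℝ)| := by
        rw [Int.cast_sum]
        exact abs_sum_le_sum_abs _ _
    _ ≤ ∑ _σ : Equiv.Perm ι, _ := sum_le_sum fun σ _ => hterm σ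
    _ = _ := by rw [sum_const, card_univ, Fintype.card_perm, nsmul_eq_mul, mul_assoc]

open Finset in
theorem sum_centered_sq_range (n : ℕ) :
    ∑ i ∈ range n, ((i : ℝ) - ((n : ℝ) - 1) / 2) ^ 2 = n * ((n : ℝ) ^ 2 - 1) / 12 := by
  have h1 : ∀ m : ℕ, ∑ i ∈ range m, (i : ℝ) = m * (m - 1) / 2 := fun m => by
    induction m with
    | zero => simp
    | succ m ih => rw [sum_range_succ, ih]; push_cast; ring
  have h2 : ∀ m : ℕ, ∑ i ∈ range m, (i : ℝ) ^ 2 = m * (m - 1) * (2 * m - 1) / 6 := fun m => by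
    induction m with
    | zero => simp
    | succ m ih => rw [sum_range_succ, ih]; push_cast; ring
  simp only [sub_sq, sum_add_distrib, sum_sub_distrib, ← sum_mul, ← mul_sum, h1, h2, sum_const,
    card_range, nsmul_eq_mul]
  ring

open Finset in
theorem sum_perm_mul_sub_le {ι : Type*} [Fintype ι] (l r : ι → ℝ) (u v : ℝ) {X Y D : ℝ}
    (hX : ∑ i, (l i - u) ^ 2 ≤ X) (hY : ∑ i, (r i - v) ^ 2 ≤ Y) (hD : 0 ≤ D)
    (hXY : 4 * (X * Y) ≤ D ^ 2) (σ τ : Equiv.Perm ι) :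
    ∑ i, l (σ i) * r i - ∑ i, l (τ i) * r i ≤ D := by
  have hl : ∀ ρ : Equiv.Perm ι, ∑ i, l (ρ i) = ∑ i, l i := fun ρ => Equiv.sum_comp ρ l
  have hX0 : 0 ≤ X := (sum_nonneg fun _ _ => sq_nonneg _).trans hX
  have key : ∀ ρ : Equiv.Perm ι, |∑ i, (l (ρ i) - u) * (r i - v)| ≤ D / 2 := by
    intro ρ
    apply abs_le_of_sq_le_sq _ (by linarith)
    calc (∑ i, (l (ρ i) - u) * (r i - v)) ^ 2
        ≤ (∑ i, (l (ρ i) - u) ^ 2) * ∑ i, (r i - v) ^ 2 := sum_mul_sq_le_sq_mul_sq _ _ _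
      _ = (∑ i, (l i - u) ^ 2) * ∑ i, (r i - v) ^ 2 := by
        rw [Equiv.sum_comp ρ fun i => (l i - u) ^ 2]
      _ ≤ X * Y := mul_le_mul hX hY (sum_nonneg fun _ _ => sq_nonneg _) hX0
      _ ≤ (D / 2) ^ 2 := by linarith [div_pow D 2 2]
  have hexpand : ∀ ρ : Equiv.Perm ι, ∑ i, (l (ρ i) - u) * (r i - v) =
      ∑ i, l (ρ i) * r i - v * ∑ i, l i - u * ∑ i, (r i - v) := by
    intro ρ
    rw [← hl ρ, mul_sum, mul_sum, ← sum_sub_distrib, ← sum_sub_distrib]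
    exact sum_congr rfl fun i _ => by ring
  have h1 := (abs_le.mp (key σ)).2
  have h2 := (abs_le.mp (key τ)).1
  rw [hexpand] at h1 h2
  linarith

open Finset in
theorem sum_prod_fin_sub_sq_le {ι : Type*} [Fintype ι] {R S : ℕ} {p : ι → Fin R × Fin S}
    (hp : Function.Injective p) :
    ∑ i, ((((p i).1 : ℕ) : ℝ) - ((R : ℝ) - 1) / 2) ^ 2 ≤ (S : ℝ) * R ^ 3 / 12 := by
  calc ∑ i, ((((p i).1 : ℕ) : ℝ) - ((R : ℝ) - 1) / 2) ^ 2
      = ∑ t ∈ univ.map ⟨p, hp⟩, (((t.1 : ℕ) : ℝ) - ((R : ℝ) - 1) / 2) ^ 2 := by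
        rw [sum_map]; rfl
    _ ≤ ∑ t : Fin R × Fin S, (((t.1 : ℕ) : ℝ) - ((R : ℝ) - 1) / 2) ^ 2 :=
        sum_le_univ_sum_of_nonneg fun _ => sq_nonneg _
    _ = S * (R * ((R : ℝ) ^ 2 - 1) / 12) := by
        rw [Fintype.sum_prod_type, ← sum_centered_sq_range R,
          ← Fin.sum_univ_eq_sum_range (fun i => ((i : ℝ) - ((R : ℝ) - 1) / 2) ^ 2) R, mul_sum]
        simp
    _ ≤ (S : ℝ) * R ^ 3 / 12 := by
        have : (0 : ℝ) ≤ S * R := by positivity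
        linarith [show (S : ℝ) * (R * ((R : ℝ) ^ 2 - 1) / 12) = S * R ^ 3 / 12 - S * R / 12 by ring]

open Finset in
theorem two_pow_le_of_two_pow_dvd_sub {a b : ℤ} {x y α N : ℕ} (hα : α ≠ 0)
    (ha1 : 1 < a.natAbs) (hb1 : 1 < b.natAbs) (hab : IsCoprime a b) (hxy : x.Coprime y)
    (ha : 2 ^ α ∣ a - 1) (hb : 2 ^ α ∣ b - 1) (h : 2 ^ N ∣ a ^ x - b ^ y)
    {K L R₁ S₁ R₂ S₂ : ℕ} (hK0 : K ≠ 0) (hL0 : L ≠ 0) (hN : α * (K * L) ≤ N)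
    (hL : L ≤ R₁ * S₁) (hK : L * (K - 1) < R₂ * S₂) (hRS : R₂ ≤ x ∨ S₂ ≤ y)
    {W : ℝ} (hW : ((R₁ + R₂ - 2 : ℕ) : ℝ) * y + ((S₁ + S₂ - 2 : ℕ) : ℝ) * x ≤ W)
    {R S : ℕ} (hR : R = R₁ + R₂ - 1) (hS : S = S₁ + S₂ - 1) :
    (2 : ℝ) ^ (α * (∑ v ∈ range (K * L), v - L * ∑ k ∈ range K, k)) ≤
      (K * L).factorial * (∏ k ∈ range K, W ^ k / k.factorial) ^ L *
      Real.exp (L / 6 * √(K * L * (R * S)) *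
        (R * Real.log |(a : ℝ)| + S * Real.log |(b : ℝ)|)) := by
  have hodd : ∀ t : ℤ, 2 ^ α ∣ t - 1 → Odd t := fun t ht => by
    obtain ⟨c, hc⟩ := (dvd_pow_self 2 hα).trans ht
    exact ⟨c, by linarith⟩
  have hex := exists_interpolation_det_ne_zero ha1 hb1 hab hxy hL hK hRS
  rw [← hR, ← hS] at hex
  obtain ⟨p, hp, hdet⟩ := hex
  have hne : Nonempty (Fin K × Fin L) := ⟨⟨0, by omega⟩, ⟨0, by omega⟩⟩
  have hcard : Fintype.card (Fin K × Fin L) = K * L := by simp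
  have hdvd := two_pow_dvd_interpolation_det hα hxy ha hb h (ι := Fin K × Fin L)
    (by rw [hcard]; exact hN) (fun i => i.1) (fun i => i.2) (fun j => (p j).1) fun j => (p j).2
  have hsum : ∑ i : Fin K × Fin L, (i.1 : ℕ) = L * ∑ k ∈ range K, k := by
    rw [Fintype.sum_prod_type, ← Fin.sum_univ_eq_sum_range (fun i => i) K, mul_sum]
    simp
  rw [hcard, hsum] at hdvd
  have hX : ∑ i : Fin K × Fin L, (((i.2 : ℕ) : ℝ) - ((L : ℝ) - 1) / 2) ^ 2 ≤ (K : ℝ) * L ^ 3 / 12 := by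
    have := sum_prod_fin_sub_sq_le (Prod.swap_injective (α := Fin K) (β := Fin L))
    simpa using this
  have hY := sum_prod_fin_sub_sq_le hp
  have hY' := sum_prod_fin_sub_sq_le (Prod.swap_injective.comp hp)
  have hsq : (√((K : ℝ) * L * (R * S))) ^ 2 = K * L * (R * S) := Real.sq_sqrt (by positivity)
  refine (two_pow_le_of_dvd_det (hodd a ha) (hodd b hb)
    (fun i j : Fin K × Fin L => ((((p j).1 : ℕ) * y + ((p j).2 : ℕ) * x).choose i.1 : ℤ))
    (fun i => i.2) (fun j => (p j).1) (fun j => (p j).2)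
    (fun i => W ^ (i.1 : ℕ) / (i.1 : ℕ).factorial) ?_
    (Da := L / 6 * √(K * L * (R * S)) * R) (Db := L / 6 * √(K * L * (R * S)) * S)
    ?_ ?_ hdet hdvd).trans_eq ?_
  · intro i j
    rw [Int.cast_natCast, Nat.abs_cast]
    refine (Nat.choose_le_pow_div _ _).trans ?_
    gcongr
    refine le_trans ?_ hW
    push_cast
    have h1 := (p j).1.isLt
    have h2 := (p j).2.isLt
    gcongr <;> omega
  · refine sum_perm_mul_sub_le (fun i : Fin K × Fin L => ((i.2 : ℕ) : ℝ)) _ _ _ hX hY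
      (by positivity) (le_of_eq ?_)
    rw [mul_pow, mul_pow, hsq]
    ring
  · refine sum_perm_mul_sub_le (fun i : Fin K × Fin L => ((i.2 : ℕ) : ℝ)) _ _ _ hX hY'
      (by positivity) (le_of_eq ?_)
    rw [mul_pow, mul_pow, hsq]
    ring
  · rw [hcard, Fintype.prod_prod_type, ← Fin.prod_univ_eq_prod_range]
    simp only [prod_const, card_univ, Fintype.card_fin, prod_pow]
    ring_nf

theorem Real.mul_log_sub_add_half_le_log_factorial {n : ℕ} (hn : n ≠ 0) :
    n * Real.log n - n + 1 / 2 ≤ Real.log n.factorial := by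
  have hn1 : (1 : ℝ) ≤ n := by exact_mod_cast Nat.one_le_iff_ne_zero.mpr hn
  have h1 := Real.log_le_log (by positivity) (Stirling.le_factorial_stirling n)
  rw [Real.log_mul (by positivity) (by positivity), Real.log_pow,
    Real.log_div (by positivity) (Real.exp_pos 1).ne', Real.log_exp,
    Real.log_sqrt (by positivity)] at h1
  have h2 : 1 ≤ Real.log (2 * Real.pi * n) := by
    rw [Real.le_log_iff_exp_le (by positivity)]
    have := Real.exp_one_lt_d9
    nlinarith [Real.pi_gt_three]
  linarith

open Finset in
theorem sum_log_pow_div_factorial_le {W : ℝ} (hW : 0 < W) (K : ℕ) :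
    ∑ k ∈ range K, Real.log (W ^ k / k.factorial) ≤
      K * (K - 1) / 2 * (Real.log (W / K) + 3 / 2) := by
  induction K with
  | zero => simp
  | succ K ih =>
    rw [sum_range_succ]
    rcases Nat.eq_zero_or_pos K with rfl | hK
    · simp
    · have hK' : (1 : ℝ) ≤ K := by exact_mod_cast hK
      have h1 := Real.mul_log_sub_add_half_le_log_factorial hK.ne'
      have h2 : Real.log (K + 1) ≤ Real.log K + 1 / K := by
        have h3 := Real.log_le_sub_one_of_pos (show 0 < ((K : ℝ) + 1) / K by positivity)
        rw [Real.log_div (by positivity) (by positivity)] at h3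
        have h4 : ((K : ℝ) + 1) / K - 1 = 1 / K := by field_simp; ring
        linarith
      have h5 := mul_le_mul_of_nonneg_left h2 (show (0 : ℝ) ≤ K * (K + 1) / 2 by positivity)
      have h6 : (K : ℝ) * (K + 1) / 2 * (Real.log K + 1 / K) =
          K * (K + 1) / 2 * Real.log K + (K + 1) / 2 := by field_simp
      rw [Real.log_div (by positivity) (by positivity)] at ih
      rw [Real.log_div (by positivity) (by positivity), Real.log_div (by positivity)
        (by positivity), Real.log_pow]
      push_cast
      nlinarith

open Finset in
/-- The inequality between parameters forced by a non-vanishing interpolation determinant. -/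
theorem interpolation_inequality {a b : ℤ} {x y α N : ℕ} (hα : α ≠ 0)
    (ha1 : 1 < a.natAbs) (hb1 : 1 < b.natAbs) (hab : IsCoprime a b) (hxy : x.Coprime y)
    (ha : 2 ^ α ∣ a - 1) (hb : 2 ^ α ∣ b - 1) (h : 2 ^ N ∣ a ^ x - b ^ y)
    {K L R₁ S₁ R₂ S₂ : ℕ} (hK0 : K ≠ 0) (hL0 : L ≠ 0) (hN : α * (K * L) ≤ N)
    (hL : L ≤ R₁ * S₁) (hK : L * (K - 1) < R₂ * S₂) (hRS : R₂ ≤ x ∨ S₂ ≤ y)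
    {W : ℝ} (hW0 : 0 < W)
    (hW : ((R₁ + R₂ - 2 : ℕ) : ℝ) * y + ((S₁ + S₂ - 2 : ℕ) : ℝ) * x ≤ W)
    {R S : ℕ} (hR : R = R₁ + R₂ - 1) (hS : S = S₁ + S₂ - 1) :
    α * Real.log 2 * (L - 1) * K ≤ 2 * Real.log (K * L) +
      (K - 1) * (Real.log (W / K) + 3 / 2) +
      √(K * L * (R * S)) / (3 * K) * (R * Real.log |(a : ℝ)| + S * Real.log |(b : ℝ)|) := by
  have key := two_pow_le_of_two_pow_dvd_sub hα ha1 hb1 hab hxy ha hb h hK0 hL0 hN hL hK hRS hW hR hS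
  have hKp : (0 : ℝ) < K := by exact_mod_cast Nat.pos_of_ne_zero hK0
  have hLp : (0 : ℝ) < L := by exact_mod_cast Nat.pos_of_ne_zero hL0
  have hprod : 0 < ∏ k ∈ range K, W ^ k / (k.factorial : ℝ) := prod_pos fun k _ => by positivity
  have hfac : (0 : ℝ) < (K * L).factorial := by positivity
  have h1 := Real.log_le_log (by positivity) key
  rw [Real.log_mul (by positivity) (Real.exp_pos _).ne', Real.log_mul hfac.ne' (by positivity),
    Real.log_exp, Real.log_pow, Real.log_pow, Real.log_prod (fun k _ => by positivity)] at h1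
  have h2 : Real.log (K * L).factorial ≤ K * L * Real.log (K * L) := by
    have h := Real.log_le_log hfac (Nat.cast_le.mpr (Nat.factorial_le_pow (K * L)))
    rw [Nat.cast_pow, Real.log_pow] at h
    exact_mod_cast h
  have h3 := mul_le_mul_of_nonneg_left (sum_log_pow_div_factorial_le hW0 K) hLp.le
  have hsumr : ∀ m : ℕ, (∑ v ∈ range m, (v : ℝ)) = m * (m - 1) / 2 := fun m => by
    induction m with
    | zero => simp
    | succ m ih => rw [sum_range_succ, ih]; push_cast; ring
  have h4 : (K : ℝ) * L * (L - 1) * K / 2 =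
      (K * L) * (K * L - 1) / 2 - L * (K * (K - 1) / 2) := by ring
  have h5 : (α : ℝ) * (K * L * (L - 1) * K / 2) ≤
      ((α * (∑ v ∈ range (K * L), v - L * ∑ k ∈ range K, k) : ℕ) : ℝ) := by
    rw [Nat.cast_mul]
    refine mul_le_mul_of_nonneg_left ?_ (Nat.cast_nonneg _)
    rw [h4]
    have h6 : ((∑ v ∈ range (K * L), v : ℕ) : ℝ) ≤
        ((∑ v ∈ range (K * L), v - L * ∑ k ∈ range K, k : ℕ) : ℝ) +
          ((L * ∑ k ∈ range K, k : ℕ) : ℝ) := by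
      exact_mod_cast le_tsub_add
    push_cast at h6
    rw [hsumr, hsumr] at h6
    push_cast at h6 ⊢
    linarith
  have h7 := mul_le_mul_of_nonneg_right h5 (Real.log_nonneg (one_le_two))
  set G := R * Real.log |(a : ℝ)| + S * Real.log |(b : ℝ)|
  set q := √((K : ℝ) * L * (R * S))
  have h8 : (K : ℝ) * L / 2 * (α * Real.log 2 * (L - 1) * K) ≤ K * L / 2 *
      (2 * Real.log (K * L) + (K - 1) * (Real.log (W / K) + 3 / 2) + q / (3 * K) * G) := by
    have h9 : (K : ℝ) * L / 2 * (q / (3 * K) * G) = L / 6 * q * G := by field_simp; ring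
    rw [mul_add, h9]
    linarith
  exact le_of_mul_le_mul_left h8 (by positivity)

/-- The choice of the numbers of powers and of binomial coefficients. -/
theorem exists_interpolation_sizes {α N : ℕ} {s p : ℝ} (hα : α ≠ 0) (hs : 52 ≤ s)
    (hp : α * Real.log 2 ≤ p) (hN : s ^ 2 * p ^ 2 = α * N) :
    ∃ K L : ℕ, 65 ≤ K ∧ 18.72 ≤ (L : ℝ) ∧ L ≤ K ∧ 0.36 * s ≤ L ∧ L ≤ 0.37924 * s ∧
      α * (K * L) ≤ N ∧ p * s ≤ 1.0077 * α * (√L * √K) := by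
  have hα0 : (0 : ℝ) < α := by exact_mod_cast Nat.pos_of_ne_zero hα
  have hL1 := Nat.le_ceil (0.36 * s)
  have hL2 := Nat.ceil_lt_add_one (show 0 ≤ 0.36 * s by linarith)
  set L := ⌈0.36 * s⌉₊
  have hLp : (0 : ℝ) < L := by linarith
  have hLs : (L : ℝ) ≤ 0.37924 * s := by linarith
  have hN1 : N < α * L * (N / (α * L) + 1) := by
    have : 0 < α * L := by
      have : 0 < L := by exact_mod_cast hLp
      positivity
    exact Nat.lt_mul_div_succ N this
  have hN2 : α * L * (N / (α * L)) ≤ N := Nat.mul_div_le N (α * L)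
  set K := N / (α * L)
  have hN3 : (N : ℝ) < α * L * (K + 1) := by exact_mod_cast hN1
  have hp2 : (α * 0.693) ^ 2 ≤ p ^ 2 := by
    have := Real.log_two_gt_d9
    gcongr
    refine le_trans ?_ hp
    gcongr
    linarith
  have h1 : 0.48 * s ^ 2 < L * (K + 1) := by
    have h2 : s ^ 2 * ((α : ℝ) * 0.693) ^ 2 < α * (α * L * (K + 1)) :=
      calc s ^ 2 * ((α : ℝ) * 0.693) ^ 2 ≤ s ^ 2 * p ^ 2 := by gcongr
        _ = (α : ℝ) * N := hN
        _ < _ := by gcongr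
    have h3 : (α : ℝ) ^ 2 * (s ^ 2 * 0.693 ^ 2) < α ^ 2 * (L * (K + 1)) := by linarith
    have h4 := lt_of_mul_lt_mul_left h3 (by positivity)
    nlinarith [sq_nonneg s]
  have hK : 65 ≤ K := by
    by_contra! hlt
    have h2 : (K : ℝ) + 1 ≤ 65 := by exact_mod_cast hlt
    have h3 : L * ((K : ℝ) + 1) ≤ (0.36 * s + 1) * 65 := by gcongr
    nlinarith
  have hKr : (65 : ℝ) ≤ K := by exact_mod_cast hK
  refine ⟨K, L, hK, by linarith, ?_, hL1, hLs, by linarith [mul_comm K L], ?_⟩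
  · by_contra! hlt
    have h2 : (K : ℝ) + 1 ≤ L := by exact_mod_cast hlt
    have h3 : L * ((K : ℝ) + 1) ≤ 0.37924 * s * (0.37924 * s) := by
      gcongr
      exact h2.trans hLs
    nlinarith
  · refine (abs_le_of_sq_le_sq' ?_ (by positivity)).2
    rw [mul_pow, mul_pow, mul_pow, mul_pow, Real.sq_sqrt hLp.le, Real.sq_sqrt (by positivity)]
    have h2 : s ^ 2 * p ^ 2 ≤ α * (α * L * (K + 1)) := by rw [hN]; gcongr
    have h3 : (K : ℝ) + 1 ≤ 1.0077 ^ 2 * K := by linarith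
    calc p ^ 2 * s ^ 2 ≤ α * (α * L * (K + 1)) := by linarith
      _ ≤ α * (α * L * (1.0077 ^ 2 * K)) := by gcongr
      _ = _ := by ring

theorem interpolation_gram_bound {α s p u v E K L R S : ℝ} (hα : 0 < α) (hs : 52 ≤ s)
    (hp0 : 0 < p) (huv : u * v = 1) (hE : α * 0.693 ≤ E) (hu : E ≤ p * u) (hv : E ≤ p * v)
    (hL : 18.72 ≤ L) (hK : 65 ≤ K) (hpKL : p * s ≤ 1.0077 * α * (√L * √K))
    (hLs : L ≤ 0.37924 * s) (hR0 : 0 ≤ R) (hS0 : 0 ≤ S) (hR : R ≤ √L * (1 + √K) * u + 1)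
    (hS : S ≤ √L * (1 + √K) * v + 1) :
    √(K * L * (R * S)) / (3 * K) * (R * (p * v) + S * (p * u)) ≤ 0.3397 * α * L * K := by
  have hl2 : √L ^ 2 = L := Real.sq_sqrt (by linarith)
  have hk2 : √K ^ 2 = K := Real.sq_sqrt (by linarith)
  have hl0 : 4.32 ≤ √L := Real.le_sqrt_of_sq_le (by linarith)
  have hk0 : 8.06 ≤ √K := Real.le_sqrt_of_sq_le (by linarith)
  set l := √L
  set k := √K
  have hE0 : 0 < E := by linarith
  have hu0 : 0 < u := pos_of_mul_pos_right (hE0.trans_le hu) hp0.le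
  have hv0 : 0 < v := pos_of_mul_pos_right (hE0.trans_le hv) hp0.le
  have hlk : 34.8 ≤ l * k := by nlinarith
  have hpE : p ≤ 0.028 * E * (l * k) := by
    have h1 : p * 52 ≤ 1.0077 * α * (l * k) := (by gcongr : p * 52 ≤ p * s).trans hpKL
    have h2 : α * 0.693 * (l * k) ≤ E * (l * k) := by gcongr
    linarith
  have hEp : E ≤ p := by
    have h1 : E ^ 2 ≤ p ^ 2 := by
      calc E ^ 2 = E * E := sq E
        _ ≤ (p * u) * (p * v) := by gcongr
        _ = p ^ 2 * (u * v) := by ring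
        _ = p ^ 2 := by rw [huv, mul_one]
    exact (abs_le_of_sq_le_sq' h1 hp0.le).2
  have hσ : u + v ≤ 0.0569 * (l * k) := by
    have h1 : E * p * (u + v) ≤ p * (p + E) := by
      have := mul_nonneg (sub_nonneg.mpr hu) (sub_nonneg.mpr hv)
      have h3 : (p * u) * (p * v) = p ^ 2 := by 
        rw [show (p * u) * (p * v) = p ^ 2 * (u * v) by ring, huv, mul_one]
      nlinarith
    have h2 : p * (E * (u + v)) ≤ p * (E * (0.028 * (l * k) + 1)) := by
      have : p * (p + E) ≤ p * (0.028 * E * (l * k) + E) := by gcongr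
      linarith
    have h3 := le_of_mul_le_mul_left (le_of_mul_le_mul_left h2 hp0) hE0
    linarith
  have hσ2 : 2 ≤ u + v := by nlinarith [sq_nonneg (u - v)]
  set ρ := l * (1 + k) with hρ
  have hρ0 : 0 < ρ := by positivity
  set c := ρ + (u + v) / 2 with hc
  have hcle : c ≤ 1.1545 * (l * k) := by
    have : l * 8.06 ≤ l * k := by gcongr
    rw [hc, hρ]
    linarith
  have hRS : √(K * L * (R * S)) ≤ l * k * c := by
    refine Real.sqrt_le_iff.mpr ⟨by positivity, ?_⟩
    have h1 : R * S ≤ (ρ * u + 1) * (ρ * v + 1) := by gcongr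
    have h3 : (ρ * u + 1) * (ρ * v + 1) = ρ ^ 2 * (u * v) + ρ * (u + v) + 1 := by ring
    have h4 : c ^ 2 = ρ ^ 2 + ρ * (u + v) + (u + v) ^ 2 / 4 := by ring
    have h5 : 2 ^ 2 ≤ (u + v) ^ 2 := by gcongr
    have h2 : R * S ≤ c ^ 2 := by
      rw [huv] at h3
      linarith
    calc K * L * (R * S) ≤ K * L * c ^ 2 := by gcongr
      _ = _ := by rw [← hl2, ← hk2]; ring
  have hsum : R * (p * v) + S * (p * u) ≤ 2 * p * c := by
    have h1 : R * (p * v) ≤ (ρ * u + 1) * (p * v) := by gcongr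
    have h2 : S * (p * u) ≤ (ρ * v + 1) * (p * u) := by gcongr
    have h3 : (ρ * u + 1) * (p * v) = ρ * p * (u * v) + p * v := by ring
    have h4 : (ρ * v + 1) * (p * u) = ρ * p * (u * v) + p * u := by ring
    rw [huv] at h3 h4
    rw [hc]
    linarith
  have hfin : 2 / 3 * (l * k) * p * c ^ 2 ≤ 0.3397 * α * L * K * K := by
    refine le_of_mul_le_mul_right ?_ (by linarith : 0 < s)
    calc 2 / 3 * (l * k) * p * c ^ 2 * s = 2 / 3 * (l * k) * (p * s) * c ^ 2 := by ring
      _ ≤ 2 / 3 * (l * k) * (1.0077 * α * (l * k)) * (1.1545 * (l * k)) ^ 2 := by gcongr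
      _ = 2 / 3 * 1.0077 * 1.1545 ^ 2 * α * (l ^ 2) * (k ^ 2) ^ 2 * (l ^ 2) := by ring
      _ = 2 / 3 * 1.0077 * 1.1545 ^ 2 * α * L * K ^ 2 * L := by rw [hl2, hk2]
      _ ≤ 2 / 3 * 1.0077 * 1.1545 ^ 2 * α * L * K ^ 2 * (0.37924 * s) := by gcongr
      _ = (2 / 3 * 1.0077 * 1.1545 ^ 2 * 0.37924) * (α * L * K ^ 2 * s) := by ring
      _ ≤ 0.3397 * (α * L * K ^ 2 * s) := by
        gcongr
        norm_num
      _ = _ := by ring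
  calc √(K * L * (R * S)) / (3 * K) * (R * (p * v) + S * (p * u))
      ≤ l * k * c / (3 * K) * (2 * p * c) := by gcongr
    _ = 2 / 3 * (l * k) * p * c ^ 2 / K := by ring
    _ ≤ 0.3397 * α * L * K * K / K := by gcongr
    _ = _ := by field_simp

theorem interpolation_width_le {α N s p K L Z : ℝ} (hs : 0 < s) (hα : 0 < α)
    (hp0 : 0 < p) (hN : s ^ 2 * p ^ 2 = α * N) (hL : 0 < L) (hK : 65 ≤ K) (hZ : 0 ≤ Z)
    (hpKL : p * s ≤ 1.0077 * α * (√L * √K)) (hLs : L ≤ 0.37924 * s) :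
    √L * (1 + √K) * N * Z / p / K ≤ 0.4305 / 575 * (α * s) ^ 2 * (575 * Z / α ^ 2) := by
  have hl2 : √L ^ 2 = L := Real.sq_sqrt (by linarith)
  have hk2 : √K ^ 2 = K := Real.sq_sqrt (by linarith)
  have hk0 : 8.06 ≤ √K := Real.le_sqrt_of_sq_le (by linarith)
  have hl0 : 0 ≤ √L := Real.sqrt_nonneg _
  have hNp : N / p = s * (p * s) / α := by
    rw [div_eq_div_iff hp0.ne' hα.ne']
    linarith
  set l := √L
  set k := √K
  have h1 : (1 + k) * k ≤ 1.1241 * K := by rw [← hk2]; nlinarith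
  calc l * (1 + k) * N * Z / p / K = l * (1 + k) * Z * (N / p) / K := by ring
    _ = l * (1 + k) * Z * (s * (p * s) / α) / K := by rw [hNp]
    _ ≤ l * (1 + k) * Z * (s * (1.0077 * α * (l * k)) / α) / K := by gcongr
    _ = 1.0077 * s * (l ^ 2) * Z * ((1 + k) * k) / K := by field_simp
    _ ≤ 1.0077 * s * (0.37924 * s) * Z * (1.1241 * K) / K := by rw [hl2]; gcongr
    _ = (1.0077 * 0.37924 * 1.1241) * (s ^ 2 * Z) := by field_simp
    _ ≤ 0.4305 * (s ^ 2 * Z) := by gcongr; norm_num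
    _ = _ := by field_simp

theorem interpolation_parameters_contradiction {α : ℕ} {s g h K L : ℝ} (hα : 2 ≤ α) (hs : 52 ≤ s)
    (hs2 : α = 2 → 60 ≤ s) (hg : 12.505 * g ≤ α * s) (hK : 65 ≤ K) (hL0 : 0 < L)
    (hLK : L ≤ K) (hL : 0.36 * s ≤ L)
    (hh : h ≤ Real.log (0.4305 / 575 * (α * s) ^ 2) + g + 3 / 2) :
    2 * Real.log (K * L) + (K - 1) * h + 0.3397 * α * L * K < α * Real.log 2 * (L - 1) * K := by
  have hα' : (2 : ℝ) ≤ α := by exact_mod_cast hα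
  have h2l := Real.log_two_gt_d9
  have h2u := Real.log_two_lt_d9
  have hKL : 2 * Real.log (K * L) ≤ 0.257 * K := by
    have h1 : Real.log (K * L) ≤ Real.log K + Real.log K := by
      rw [← Real.log_mul (by positivity) (by positivity)]
      gcongr
    have h3 : Real.log K = Real.log (K / 64) + 6 * Real.log 2 := by
      rw [Real.log_div (by positivity) (by norm_num), show (64 : ℝ) = 2 ^ 6 by norm_num,
        Real.log_pow]
      push_cast
      ring
    have h4 := Real.log_le_sub_one_of_pos (show 0 < K / 65 by positivity)
    have h5 := Real.log_le_sub_one_of_pos (show (0 : ℝ) < 65 / 64 by norm_num)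
    have h6 : Real.log (K / 64) = Real.log (K / 65) + Real.log (65 / 64) := by
      rw [← Real.log_mul (by positivity) (by positivity)]
      congr 1
      ring
    linarith
  have hq0 : 104 ≤ α * s := by nlinarith
  have hq : 2.53 < 0.03356 * (α * s) - 0.69315 * α := by
    rcases hα.eq_or_lt with h2 | h3
    · have := hs2 h2.symm
      rw [← h2]
      push_cast
      linarith
    · have h3' : (3 : ℝ) ≤ α := by exact_mod_cast h3
      nlinarith
  set q := (α : ℝ) * s
  have hlog : Real.log (0.4305 / 575 * q ^ 2) ≤ 4 * Real.log 2 + 2 * (q / 146 - 1) := by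
    have h1 := Real.log_le_sub_one_of_pos (show 0 < q / 146 by positivity)
    have h3 : Real.log (2 ^ 4 * (q / 146) ^ 2) = 4 * Real.log 2 + 2 * Real.log (q / 146) := by
      rw [Real.log_mul (by positivity) (by positivity), Real.log_pow, Real.log_pow]
      norm_num
    have h4 : Real.log (0.4305 / 575 * q ^ 2) ≤ Real.log (2 ^ 4 * (q / 146) ^ 2) := by
      refine Real.log_le_log (by positivity) ?_
      rw [div_pow, ← mul_div_assoc, le_div_iff₀ (by positivity)]
      nlinarith [sq_nonneg q]
    linarith
  have hh' : h ≤ 2.27261 + 0.09368 * q := by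
    have h1 : 2 * (q / 146 - 1) ≤ 0.0137 * q - 2 := by linarith
    have h3 : g ≤ 0.07997 * q := by linarith
    linarith
  have hKh : (K - 1) * h ≤ K * (2.27261 + 0.09368 * q) := by
    calc (K - 1) * h ≤ (K - 1) * (2.27261 + 0.09368 * q) := by
          gcongr
          linarith
      _ ≤ K * (2.27261 + 0.09368 * q) := by
          gcongr
          linarith
  have hαL : 0.36 * q ≤ α * L := by
    have : (α : ℝ) * (0.36 * s) ≤ α * L := by gcongr
    linarith
  have hfin : 0.257 + (2.27261 + 0.09368 * q) + 0.3397 * (α * L) <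
      Real.log 2 * (α * L) - Real.log 2 * α := by
    have h1 : 0.6931471 * (α * L) ≤ Real.log 2 * (α * L) := by gcongr; linarith
    have h3 : Real.log 2 * α ≤ 0.69315 * α := by gcongr; linarith
    linarith
  have := mul_lt_mul_of_pos_right hfin (show 0 < K by linarith)
  linarith

/-- If `a ^ x - b ^ y` is divisible by `2 ^ N`, then `N` cannot be too large. -/
theorem not_two_pow_dvd_pow_sub_pow {a b : ℤ} {x y α N : ℕ} {A B Z g s : ℝ} (hα : 2 ≤ α)
    (ha1 : 1 < a.natAbs) (hb1 : 1 < b.natAbs) (hab : IsCoprime a b) (hxy : x.Coprime y)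
    (hx : x ≠ 0) (ha : 2 ^ α ∣ a - 1) (hb : 2 ^ α ∣ b - 1)
    (hA : Real.log |(a : ℝ)| ≤ A) (hB : Real.log |(b : ℝ)| ≤ B)
    (hA2 : α * Real.log 2 ≤ A) (hB2 : α * Real.log 2 ≤ B) (hxyZ : x * A + y * B ≤ N * Z)
    (hs : 52 ≤ s) (hs2 : α = 2 → 60 ≤ s) (hsN : s ^ 2 * (A * B) = α * N)
    (hg : 12.505 * g ≤ α * s) (hZg : Real.log (575 * Z / α ^ 2) ≤ g) :
    ¬ (2 ^ N ∣ a ^ x - b ^ y) := by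
  intro hdvd
  have hα' : (2 : ℝ) ≤ α := by exact_mod_cast hα
  have h2l := Real.log_two_gt_d9
  have h2u := Real.log_two_lt_d9
  set E := α * Real.log 2 with hE
  have hEα : α * 0.693 ≤ E := by rw [hE]; gcongr; linarith
  have hE0 : 0 < E := by linarith
  have hA0 : 0 < A := hE0.trans_le hA2
  have hB0 : 0 < B := hE0.trans_le hB2
  have hp2 : √(A * B) ^ 2 = A * B := Real.sq_sqrt (by positivity)
  have hp0 : 0 < √(A * B) := Real.sqrt_pos.mpr (by positivity)
  have hEp : E ≤ √(A * B) := Real.le_sqrt_of_sq_le (by rw [sq]; gcongr)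
  set p := √(A * B)
  rw [← hp2] at hsN
  obtain ⟨K, L, hK, hL, hLK, hLs, hLs', hKLN, hpKL⟩ :=
    exists_interpolation_sizes (by omega) hs hEp hsN
  have hK' : (65 : ℝ) ≤ K := by exact_mod_cast hK
  have hLK' : (L : ℝ) ≤ K := by exact_mod_cast hLK
  obtain ⟨u, hu0, hpu⟩ : ∃ u, 0 < u ∧ p * u = B := ⟨B / p, by positivity, by field_simp⟩
  obtain ⟨v, hv0, hpv⟩ : ∃ v, 0 < v ∧ p * v = A := ⟨A / p, by positivity, by field_simp⟩
  have huv : u * v = 1 := by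
    have h1 : p ^ 2 * (u * v) = p ^ 2 * 1 := 
      calc p ^ 2 * (u * v) = (p * v) * (p * u) := by ring
        _ = p ^ 2 * 1 := by rw [hpv, hpu, mul_one, hp2]
    exact mul_left_cancel₀ (by positivity) h1
  have hl2 : √(L : ℝ) ^ 2 = L := Real.sq_sqrt (by positivity)
  have hk2 : √(K : ℝ) ^ 2 = K := Real.sq_sqrt (by positivity)
  have hl0 : 0 < √(L : ℝ) := Real.sqrt_pos.mpr (by linarith)
  have hk0 : 0 < √(K : ℝ) := Real.sqrt_pos.mpr (by linarith)
  set l := √(L : ℝ)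
  set k := √(K : ℝ)
  have hceil : ∀ t : ℝ, 0 < t → 0 < ⌈t⌉₊ ∧ t ≤ ⌈t⌉₊ ∧ (⌈t⌉₊ : ℝ) < t + 1 := fun t ht =>
    ⟨Nat.ceil_pos.mpr ht, Nat.le_ceil t, Nat.ceil_lt_add_one ht.le⟩
  obtain ⟨hR₁0, hR₁, hR₁'⟩ := hceil (l * u) (by positivity)
  obtain ⟨hS₁0, hS₁, hS₁'⟩ := hceil (l * v) (by positivity)
  obtain ⟨hR₂0, hR₂, hR₂'⟩ := hceil (k * l * u) (by positivity)
  obtain ⟨hS₂0, hS₂, hS₂'⟩ := hceil (k * l * v) (by positivity)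
  set R₁ := ⌈l * u⌉₊
  set S₁ := ⌈l * v⌉₊
  set R₂ := ⌈k * l * u⌉₊
  set S₂ := ⌈k * l * v⌉₊
  have hRS1 : L ≤ R₁ * S₁ := by
    have : (L : ℝ) ≤ R₁ * S₁ :=
      calc (L : ℝ) = (l * u) * (l * v) := by
            rw [show (l * u) * (l * v) = l ^ 2 * (u * v) by ring, hl2, huv, mul_one]
        _ ≤ R₁ * S₁ := by gcongr
    exact_mod_cast this
  have hRS2 : L * (K - 1) < R₂ * S₂ := by
    have h1 : (L : ℝ) * K ≤ R₂ * S₂ :=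
      calc (L : ℝ) * K = (k * l * u) * (k * l * v) := by
            rw [show (k * l * u) * (k * l * v) = l ^ 2 * k ^ 2 * (u * v) by ring, hl2, hk2, huv,
              mul_one]
        _ ≤ R₂ * S₂ := by gcongr
    have h3 : L * K ≤ R₂ * S₂ := by exact_mod_cast h1
    refine lt_of_lt_of_le ?_ h3
    have : 0 < L := by exact_mod_cast (show (0 : ℝ) < L by linarith)
    exact Nat.mul_lt_mul_of_pos_left (by omega) this
  have hRS3 : R₂ ≤ x ∨ S₂ ≤ y := by
    by_contra! hlt
    have hx2 : (x : ℝ) ≤ k * l * u := by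
      have : (x : ℝ) + 1 ≤ R₂ := by exact_mod_cast hlt.1
      linarith
    have hy2 : (y : ℝ) ≤ k * l * v := by
      have : (y : ℝ) + 1 ≤ S₂ := by exact_mod_cast hlt.2
      linarith
    have hpow : ∀ (t : ℤ) (ht : 1 < t.natAbs) (m : ℕ) (C : ℝ), m * Real.log |(t : ℝ)| ≤ C →
        |(t : ℝ) ^ m| ≤ Real.exp C := by
      intro t ht m C hC
      have h1 : (0 : ℝ) < |(t : ℝ)| := by
        rw [abs_pos]
        rintro h
        have : t = 0 := by exact_mod_cast h
        simp [this] at ht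
      rw [abs_pow, ← Real.exp_log (pow_pos h1 m), Real.log_pow]
      exact Real.exp_le_exp.mpr hC
    have hax := hpow a ha1 x (k * l * p) <|
      calc x * Real.log |(a : ℝ)| ≤ x * A := by gcongr
        _ ≤ (k * l * u) * A := by gcongr
        _ = k * l * p := by rw [← hpv, show (k * l * u) * (p * v) = k * l * p * (u * v) by ring,
              huv, mul_one]
    have hby := hpow b hb1 y (k * l * p) <|
      calc y * Real.log |(b : ℝ)| ≤ y * B := by gcongr
        _ ≤ (k * l * v) * B := by gcongr
        _ = k * l * p := by rw [← hpu, show (k * l * v) * (p * u) = k * l * p * (u * v) by ring,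
              huv, mul_one]
    have hne : a ^ x - b ^ y ≠ 0 := by
      intro h0
      have h1 : IsCoprime (a ^ x) (a ^ x) := by
        nth_rewrite 2 [sub_eq_zero.mp h0]
        exact hab.pow
      have h3 := Int.isUnit_iff_natAbs_eq.mp (isCoprime_self.mp h1)
      rw [Int.natAbs_pow] at h3
      exact (Nat.one_lt_pow hx ha1).ne' h3
    have h1 : (2 : ℝ) ^ N ≤ 2 * Real.exp (k * l * p) := by
      have h3 := Int.le_of_dvd (abs_pos.mpr hne) ((dvd_abs _ _).mpr hdvd)
      have h4 : (2 : ℝ) ^ N ≤ |(a : ℝ) ^ x - (b : ℝ) ^ y| := by exact_mod_cast h3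
      have h5 := abs_sub (a ^ x : ℝ) (b ^ y)
      linarith
    have h3 := Real.log_le_log (by positivity) h1
    rw [Real.log_mul (by norm_num) (Real.exp_pos _).ne', Real.log_exp, Real.log_pow] at h3
    have h4 : k * l * p ≤ 0.02 * (α * (L * K)) := by
      refine le_of_mul_le_mul_right ?_ (by linarith : 0 < s)
      calc k * l * p * s = k * l * (p * s) := by ring
        _ ≤ k * l * (1.0077 * α * (l * k)) := by gcongr
        _ = 1.0077 * (α * (l ^ 2 * k ^ 2)) := by ring
        _ = 1.0077 * (α * (L * K)) := by rw [hl2, hk2]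
        _ ≤ 0.02 * 52 * (α * (L * K)) := by gcongr; norm_num
        _ = 0.02 * (α * (L * K)) * 52 := by ring
        _ ≤ _ := by gcongr
    have h5 : (α : ℝ) * (K * L) ≤ N := by exact_mod_cast hKLN
    have h6 : (2 : ℝ) * (18.72 * 65) ≤ α * (L * K) := by gcongr
    have h7 : 0.69 * (N : ℝ) ≤ N * Real.log 2 := by
      rw [mul_comm]; gcongr; linarith
    linarith
  have hNpos : (0 : ℝ) < N := by
    have : 0 < (α : ℝ) * N := by rw [← hsN]; positivity
    exact pos_of_mul_pos_right this (by linarith)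
  have hZ : 0 < Z := by
    have h1 : 0 < (N : ℝ) * Z := by
      refine lt_of_lt_of_le ?_ hxyZ
      have : 0 < x := Nat.pos_of_ne_zero hx
      positivity
    exact pos_of_mul_pos_right h1 hNpos.le
  have hR : ((R₁ + R₂ - 2 : ℕ) : ℝ) ≤ l * (1 + k) * u := by
    rw [Nat.cast_sub (by omega)]
    push_cast
    linarith
  have hS : ((S₁ + S₂ - 2 : ℕ) : ℝ) ≤ l * (1 + k) * v := by
    rw [Nat.cast_sub (by omega)]
    push_cast
    linarith
  have hW : ((R₁ + R₂ - 2 : ℕ) : ℝ) * y + ((S₁ + S₂ - 2 : ℕ) : ℝ) * x ≤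
      l * (1 + k) * N * Z / p := by
    rw [le_div_iff₀ hp0]
    calc (((R₁ + R₂ - 2 : ℕ) : ℝ) * y + ((S₁ + S₂ - 2 : ℕ) : ℝ) * x) * p
        ≤ (l * (1 + k) * u * y + l * (1 + k) * v * x) * p := by gcongr
      _ = l * (1 + k) * (x * (p * v) + y * (p * u)) := by ring
      _ ≤ l * (1 + k) * (N * Z) := by rw [hpu, hpv]; gcongr
      _ = _ := by ring
  have hW0 : 0 < l * (1 + k) * N * Z / p := by positivity
  have key := interpolation_inequality (by omega) ha1 hb1 hab hxy ha hb hdvd (by omega)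
    (by rintro rfl; norm_num at hL) hKLN hRS1 hRS2 hRS3 hW0 hW rfl rfl
  have hR' : ((R₁ + R₂ - 1 : ℕ) : ℝ) ≤ l * (1 + k) * u + 1 := by
    rw [Nat.cast_sub (by omega)]
    push_cast
    linarith
  have hS' : ((S₁ + S₂ - 1 : ℕ) : ℝ) ≤ l * (1 + k) * v + 1 := by
    rw [Nat.cast_sub (by omega)]
    push_cast
    linarith
  have hgram := interpolation_gram_bound (by linarith) hs hp0 huv hEα (hpu ▸ hB2) (hpv ▸ hA2) hL
    hK' hpKL hLs' (Nat.cast_nonneg _) (Nat.cast_nonneg _) hR' hS'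
  have hwidth := interpolation_width_le (by linarith) (by linarith) hp0 hsN (by linarith) hK'
    hZ.le hpKL hLs'
  have hlogW : Real.log (l * (1 + k) * N * Z / p / K) + 3 / 2 ≤
      Real.log (0.4305 / 575 * (α * s) ^ 2) + g + 3 / 2 := by
    have h1 := Real.log_le_log (by positivity) hwidth
    rw [Real.log_mul (by positivity) (by positivity)] at h1
    linarith
  have hnum := interpolation_parameters_contradiction hα hs hs2 hg hK' (by linarith) hLK' hLs
    hlogW
  rw [hpu, hpv] at hgram
  refine absurd hnum (not_lt.mpr (key.trans (add_le_add_right (le_trans ?_ hgram) _)))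
  gcongr

theorem Int.two_pow_dvd_sub_one_or_add_one {a : ℤ} {k : ℕ} (ha : Odd a)
    (h : 2 ^ (k + 1) ∣ a ^ 2 - 1) : 2 ^ k ∣ a - 1 ∨ 2 ^ k ∣ a + 1 := by
  obtain ⟨m, rfl⟩ := ha
  rcases Nat.eq_zero_or_pos k with rfl | hk
  · simp
  obtain ⟨j, rfl⟩ : ∃ j, k = j + 1 := ⟨k - 1, by omega⟩
  have h1 : (2 : ℤ) ^ j ∣ m * (m + 1) := by
    have h2 : (4 : ℤ) * 2 ^ j ∣ 4 * (m * (m + 1)) := by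
      convert h using 1 <;> ring
    exact Int.dvd_of_mul_dvd_mul_left (by norm_num) h2
  have h3 : (2 : ℤ) ^ j ∣ m ∨ (2 : ℤ) ^ j ∣ m + 1 := by
    rcases Int.even_or_odd m with he | ho
    · left
      exact IsCoprime.dvd_of_dvd_mul_right
        (IsCoprime.pow_left (Int.isCoprime_two_left.mpr he.add_one)) h1
    · right
      exact IsCoprime.dvd_of_dvd_mul_left (IsCoprime.pow_left (Int.isCoprime_two_left.mpr ho)) h1
  refine h3.imp (fun h4 => ?_) fun h4 => ?_
  · exact (dvd_of_eq (by ring)).trans ((mul_dvd_mul_left 2 h4).trans (dvd_of_eq (by ring)))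
  · exact (dvd_of_eq (by ring)).trans ((mul_dvd_mul_left 2 h4).trans (dvd_of_eq (by ring)))

theorem Int.two_pow_dvd_sub_of_pow_sub_pow {u v : ℤ} {d N : ℕ} (hu : Odd u) (hv : Odd v)
    (hd : Odd d) (h : 2 ^ N ∣ u ^ d - v ^ d) : 2 ^ N ∣ u - v := by
  have h1 := emultiplicity_pow_sub_pow_of_prime Int.prime_two (hu.sub_odd hv).two_dvd
    (Int.not_even_iff_odd.mpr hu ∘ even_iff_two_dvd.mpr) (n := d)
    (by
      intro h2
      have : 2 ∣ d := by exact_mod_cast h2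
      exact Nat.not_even_iff_odd.mpr hd (even_iff_two_dvd.mpr this))
  rw [pow_dvd_iff_le_emultiplicity] at h ⊢
  rwa [← h1]

/-- Passing to coprime exponents and to bases congruent to `1` modulo `2 ^ α`. -/
theorem exists_two_pow_dvd_pow_sub_pow {a b : ℤ} {α N x y : ℕ} (hα : 2 ≤ α) (hN : 2 ≤ N)
    (ha : Odd a) (hb : Odd b) (ha2 : 2 ^ (α + 1) ∣ a ^ 2 - 1) (hb2 : 2 ^ (α + 1) ∣ b ^ 2 - 1)
    (hx : x ≠ 0) (h : 2 ^ N ∣ a ^ x + b ^ y) :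
    ∃ a' b' : ℤ, ∃ x' y' : ℕ, (a' = a ∨ a' = -a) ∧ (b' = b ∨ b' = -b) ∧ 2 ^ α ∣ a' - 1 ∧
      2 ^ α ∣ b' - 1 ∧ x' ≠ 0 ∧ x' ≤ x ∧ y' ≤ y ∧ x'.Coprime y' ∧ 2 ^ N ∣ a' ^ x' - b' ^ y' := by
  have hsign : ∀ t : ℤ, Odd t → 2 ^ (α + 1) ∣ t ^ 2 - 1 →
      ∃ t' : ℤ, (t' = t ∨ t' = -t) ∧ 2 ^ α ∣ t' - 1 := by
    intro t ht h2
    rcases Int.two_pow_dvd_sub_one_or_add_one ht h2 with h3 | h3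
    · exact ⟨t, Or.inl rfl, h3⟩
    · refine ⟨-t, Or.inr rfl, ?_⟩
      exact h3.trans ((dvd_of_eq (by ring)).trans (neg_dvd.mpr (dvd_refl (-t - 1))))
  obtain ⟨a', ha', haα⟩ := hsign a ha ha2
  obtain ⟨b', hb', hbα⟩ := hsign b hb hb2
  have hodd : ∀ t t' : ℤ, Odd t → (t' = t ∨ t' = -t) → Odd t' := by
    rintro t t' ht (rfl | rfl)
    · exact ht
    · exact ht.neg
  have hao := hodd a a' ha ha'
  have hbo := hodd b b' hb hb'
  have h4 : (4 : ℤ) ∣ a ^ x + b ^ y := (pow_dvd_pow 2 hN).trans h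
  have hpow : ∀ t t' : ℤ, (t' = t ∨ t' = -t) → 2 ^ α ∣ t' - 1 → ∀ m : ℕ,
      4 ∣ t' ^ m - 1 ∧ (t ^ m = t' ^ m ∨ t ^ m = -t' ^ m) := by
    intro t t' ht h1 m
    refine ⟨((pow_dvd_pow 2 hα).trans h1).trans (by simpa using sub_dvd_pow_sub_pow t' 1 m), ?_⟩
    rcases ht with rfl | rfl
    · exact Or.inl rfl
    · rcases m.even_or_odd with hm | hm
      · exact Or.inl (hm.neg_pow t).symm
      · exact Or.inr (by rw [hm.neg_pow, neg_neg])
  obtain ⟨hax4, hax⟩ := hpow a a' ha' haα x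
  obtain ⟨hby4, hby⟩ := hpow b b' hb' hbα y
  have hdvd : 2 ^ N ∣ a' ^ x - b' ^ y := by
    rcases hax with hax | hax <;> rcases hby with hby | hby <;> rw [hax, hby] at h h4
    · omega
    · rwa [← sub_eq_add_neg] at h
    · exact h.trans ((dvd_of_eq (by ring)).trans (neg_dvd.mpr (dvd_refl (a' ^ x - b' ^ y))))
    · omega
  have hg : Odd (x.gcd y) := by
    by_contra hne
    rw [Nat.not_odd_iff_even, even_iff_two_dvd, Nat.dvd_gcd_iff] at hne
    obtain ⟨⟨i, rfl⟩, ⟨j, rfl⟩⟩ := hne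
    have h5 : ∀ t : ℤ, Odd t → ∀ m : ℕ, 4 ∣ t ^ (2 * m) - 1 := by
      intro t ht m
      obtain ⟨w, rfl⟩ := ht
      have h6 : (4 : ℤ) ∣ (2 * w + 1) ^ 2 - 1 := ⟨w * (w + 1), by ring⟩
      refine h6.trans ?_
      rw [pow_mul]
      have h9 := sub_dvd_pow_sub_pow ((2 * w + 1) ^ 2) 1 m
      rwa [one_pow] at h9
    have h7 := h5 a ha i
    have h8 := h5 b hb j
    omega
  obtain ⟨x', y', hcop, hx', hy'⟩ := Nat.exists_coprime x y
  have hg0 : 0 < x.gcd y := hg.pos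
  refine ⟨a', b', x', y', ha', hb', haα, hbα, ?_, ?_, ?_, hcop, ?_⟩
  · rintro rfl
    exact hx (by rw [hx', zero_mul])
  · exact (Nat.le_mul_of_pos_right x' hg0).trans hx'.ge
  · exact (Nat.le_mul_of_pos_right y' hg0).trans hy'.ge
  · have hxe : a' ^ x = (a' ^ x') ^ x.gcd y := by rw [← pow_mul, ← hx']
    have hye : b' ^ y = (b' ^ y') ^ x.gcd y := by rw [← pow_mul, ← hy']
    rw [hxe, hye] at hdvd
    exact Int.two_pow_dvd_sub_of_pow_sub_pow hao.pow hbo.pow hg hdvd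

/-- An upper bound for `z` when `a ^ x + b ^ y = c ^ z`, in terms of admissible constants. -/
theorem lt_of_pow_add_pow_eq_pow {a b c x y z α β : ℕ} {m k₁ k₂ k₃ : ℝ} (ha : 1 < a) (hb : 1 < b)
    (hc : 1 < c) (haodd : Odd a) (hbodd : Odd b) (hab : a.Coprime b) (hα : 2 ≤ α) (hβ : 0 < β)
    (haα : 2 ^ (α + 1) ∣ (a : ℤ) ^ 2 - 1) (hbα : 2 ^ (α + 1) ∣ (b : ℤ) ^ 2 - 1) (hcβ : 2 ^ β ∣ c)
    (hm : 1 ≤ m) (hA : α * Real.log 2 ≤ m * Real.log a) (hB : α * Real.log 2 ≤ Real.log b)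
    (hk₁ : 2704 * m ≤ k₁ * α * β) (hk₁' : α = 2 → 3600 * m ≤ k₁ * α * β)
    (hk₂ : 12.505 ^ 2 * m ≤ k₂ * α ^ 3 * β) (hk₃ : 575 * (m + 1) / (α ^ 2 * β) ≤ k₃)
    (hx : 0 < x) (hz : 1 < z) (h : a ^ x + b ^ y = c ^ z) :
    (z : ℝ) < Real.log a * Real.log b *
      max k₁ (k₂ * (max 1 (Real.log (k₃ * Real.log c))) ^ 2) := by
  by_contra! hlt
  set g := max 1 (Real.log (k₃ * Real.log c)) with hg
  have hα' : (2 : ℝ) ≤ α := by exact_mod_cast hα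
  have hβ' : (1 : ℝ) ≤ β := by exact_mod_cast hβ
  have hla : 0 < Real.log a := Real.log_pos (by exact_mod_cast ha)
  have hlb : 0 < Real.log b := Real.log_pos (by exact_mod_cast hb)
  have hlc : 0 < Real.log c := Real.log_pos (by exact_mod_cast hc)
  have hdvd : (2 : ℤ) ^ (β * z) ∣ (a : ℤ) ^ x + (b : ℤ) ^ y := by
    have h1 : (2 ^ β) ^ z ∣ a ^ x + b ^ y := h ▸ pow_dvd_pow_of_dvd hcβ z
    rw [← pow_mul] at h1
    exact_mod_cast h1
  obtain ⟨a', b', x', y', ha', hb', haα', hbα', hx', hxx', hyy', hcop, hdvd'⟩ :=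
    exists_two_pow_dvd_pow_sub_pow hα (hz.trans_le (Nat.le_mul_of_pos_left z hβ))
      (by exact_mod_cast haodd) (by exact_mod_cast hbodd) haα hbα hx.ne' hdvd
  have hnat : ∀ (t : ℕ) (t' : ℤ), (t' = t ∨ t' = -t) → t'.natAbs = t := by
    rintro t t' (rfl | rfl) <;> simp
  have hna := hnat a a' ha'
  have hnb := hnat b b' hb'
  have habs : ∀ (t : ℕ) (t' : ℤ), t'.natAbs = t → |(t' : ℝ)| = t := by
    rintro t t' rfl
    rw [Nat.cast_natAbs, Int.cast_abs]
  have hxc : x * Real.log a ≤ z * Real.log c := by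
    rw [← Real.log_pow, ← Real.log_pow]
    refine Real.log_le_log (by positivity) ?_
    exact_mod_cast (Nat.le_add_right _ _).trans h.le
  have hyc : y * Real.log b ≤ z * Real.log c := by
    rw [← Real.log_pow, ← Real.log_pow]
    refine Real.log_le_log (by positivity) ?_
    exact_mod_cast (Nat.le_add_left _ _).trans h.le
  have hxr : (x' : ℝ) ≤ x := by exact_mod_cast hxx'
  have hyr : (y' : ℝ) ≤ y := by exact_mod_cast hyy'
  have hz0 : (0 : ℝ) < z := by exact_mod_cast (zero_lt_one.trans hz)
  set P := m * Real.log a * Real.log b with hP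
  have hP0 : 0 < P := by positivity
  set s := √(α * ((β * z : ℕ) : ℝ) / P) with hs
  have hs2 : s ^ 2 = α * ((β * z : ℕ) : ℝ) / P := Real.sq_sqrt (by positivity)
  have hk : ∀ k, k ≤ max k₁ (k₂ * g ^ 2) → k * α * β ≤ s ^ 2 * m := by
    intro k hkle
    rw [hs2, hP]
    push_cast
    have h1 : Real.log a * Real.log b * k ≤ z := le_trans (by gcongr) hlt
    rw [div_mul_eq_mul_div, le_div_iff₀ (by positivity)]
    calc k * α * β * (m * Real.log a * Real.log b)
        = α * β * m * (Real.log a * Real.log b * k) := by ring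
      _ ≤ α * β * m * z := by gcongr
      _ = _ := by ring
  have hm0 : 0 < m := by linarith
  have hs1 : ∀ t : ℝ, 0 ≤ t → t ^ 2 * m ≤ k₁ * α * β → t ≤ s := fun t ht h1 =>
    (abs_le_of_sq_le_sq' (le_of_mul_le_mul_right (h1.trans (hk k₁ (le_max_left _ _))) hm0)
      (Real.sqrt_nonneg _)).2
  have hg0 : 0 ≤ g := zero_le_one.trans (le_max_left _ _)
  refine not_two_pow_dvd_pow_sub_pow (s := s) (g := g) (A := m * Real.log a) (B := Real.log b)
    (Z := (m + 1) * Real.log c / β) hα (by rwa [hna]) (by rwa [hnb]) ?_ hcop hx' haα' hbα'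
    ?_ ?_ hA hB ?_ (hs1 52 (by norm_num) (by linarith)) ?_ ?_ ?_ ?_ hdvd'
  · rw [Int.isCoprime_iff_gcd_eq_one, Int.gcd, hna, hnb]
    exact hab
  · rw [habs a a' hna]
    exact le_mul_of_one_le_left hla.le hm
  · rw [habs b b' hnb]
  · calc x' * (m * Real.log a) + y' * Real.log b
        ≤ x * (m * Real.log a) + y * Real.log b := by gcongr
      _ = m * (x * Real.log a) + y * Real.log b := by ring
      _ ≤ m * (z * Real.log c) + z * Real.log c := by gcongr
      _ = _ := by push_cast; field_simp
  · exact fun h2 => hs1 60 (by norm_num) (by linarith [hk₁' h2])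
  · rw [hs2, ← hP]
    field_simp
  · have h1 := hk _ (le_max_right _ _)
    refine (abs_le_of_sq_le_sq' (le_of_mul_le_mul_right ?_ hm0) (by positivity)).2
    calc (12.505 * g) ^ 2 * m = 12.505 ^ 2 * m * g ^ 2 := by ring
      _ ≤ k₂ * α ^ 3 * β * g ^ 2 := by gcongr
      _ = α ^ 2 * (k₂ * g ^ 2 * α * β) := by ring
      _ ≤ α ^ 2 * (s ^ 2 * m) := by gcongr
      _ = _ := by ring
  · refine le_trans (Real.log_le_log (by positivity) ?_) (le_max_right _ _)
    calc 575 * ((m + 1) * Real.log c / β) / α ^ 2 = 575 * (m + 1) / (α ^ 2 * β) * Real.log c := by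
          field_simp
      _ ≤ _ := by gcongr

theorem three_le_padicValNat_sq_sub_one {a : ℕ} (ha : 1 < a) (hodd : Odd a) :
    3 ≤ padicValNat 2 (a ^ 2 - 1) := by
  have h1 : a ^ 2 - 1 ≠ 0 := (Nat.sub_pos_of_lt (Nat.one_lt_pow two_ne_zero ha)).ne'
  rw [← padicValNat_dvd_iff_le h1]
  exact Nat.eight_dvd_sq_sub_one_of_odd hodd

theorem admissible_constants {a b : ℕ} {α β : ℕ} {m₂ m₃ va k₁ k₂ k₃ : ℝ} (ha : 1 < a) (hab : a < b)
    (hα : 2 ≤ α) (hβ : 0 < β) (haodd : Odd a)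
    (haα : 2 ^ (α + 1) ∣ (a : ℤ) ^ 2 - 1)
    (hm₂ : m₂ = if 7 < a then 1 else Real.log 8 / Real.log a)
    (hm₃ : m₃ = (α : ℝ) * Real.log 2 / Real.log ((2 : ℝ) ^ α - 1))
    (hva : va = 3 * (α : ℝ) * Real.log 2 - Real.log (3 * (α : ℝ) * Real.log 2))
    (hk : if α = 2 then
            (k₁, k₂, k₃) = (1803.3 * m₂ / β, 23.865 * m₂ / β, 143.75 * (m₂ + 1) / β)
          else
            (k₁, k₂, k₃) = (2705 * m₃ / (α * β),
              156.39 * m₃ * (1 + Real.log va / (va - 1)) ^ 2 / ((α : ℝ) ^ 3 * β),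
              646.9 * (m₃ + 1) / ((α : ℝ) ^ 2 * β))) :
    ∃ m : ℝ, 1 ≤ m ∧ α * Real.log 2 ≤ m * Real.log a ∧ α * Real.log 2 ≤ Real.log b ∧
      2704 * m ≤ k₁ * α * β ∧ (α = 2 → 3600 * m ≤ k₁ * α * β) ∧
      12.505 ^ 2 * m ≤ k₂ * α ^ 3 * β ∧ 575 * (m + 1) / (α ^ 2 * β) ≤ k₃ := by
  have hβ' : (0 : ℝ) < β := by exact_mod_cast hβ
  have hα' : (2 : ℝ) ≤ α := by exact_mod_cast hα
  have ha' : (1 : ℝ) < a := by exact_mod_cast ha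
  have hla : 0 < Real.log a := Real.log_pos ha'
  have h2l := Real.log_two_gt_d9
  have h2u := Real.log_two_lt_d9
  have hle : 2 ^ α ≤ a + 1 := by
    rcases Int.two_pow_dvd_sub_one_or_add_one (by exact_mod_cast haodd) haα with h | h
    · have := Int.le_of_dvd (by omega) h
      have h2 : ((2 ^ α : ℕ) : ℤ) ≤ a - 1 := by exact_mod_cast this
      omega
    · have := Int.le_of_dvd (by omega) h
      exact_mod_cast this
  have hlb : α * Real.log 2 ≤ Real.log b := by
    rw [← Real.log_pow]
    refine Real.log_le_log (by positivity) ?_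
    exact_mod_cast (show 2 ^ α ≤ b by omega)
  by_cases h2 : α = 2
  · subst h2
    rw [if_pos rfl] at hk
    obtain ⟨rfl, rfl, rfl⟩ : k₁ = _ ∧ k₂ = _ ∧ k₃ = _ := by simpa using hk
    have hm : 1 ≤ m₂ ∧ Real.log 8 ≤ m₂ * Real.log a := by
      rw [hm₂]
      split_ifs with h7
      · refine ⟨le_rfl, ?_⟩
        rw [one_mul]
        exact Real.log_le_log (by norm_num) (by exact_mod_cast h7)
      · rw [one_le_div hla, div_mul_cancel₀ _ hla.ne']
        refine ⟨Real.log_le_log (by linarith) ?_, le_rfl⟩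
        have : a ≤ 8 := by omega
        exact_mod_cast this
    have h8 : Real.log 8 = 3 * Real.log 2 := by
      rw [show (8 : ℝ) = 2 ^ 3 by norm_num, Real.log_pow]
      norm_num
    refine ⟨m₂, hm.1, ?_, hlb, ?_, fun _ => ?_, ?_, ?_⟩
    · push_cast
      linarith [hm.2]
    · field_simp
      push_cast
      linarith [hm.1]
    · field_simp
      push_cast
      linarith [hm.1]
    · field_simp
      push_cast
      linarith [hm.1]
    · push_cast
      field_simp
      linarith [hm.1]
  · rw [if_neg h2] at hk
    obtain ⟨rfl, rfl, rfl⟩ : k₁ = _ ∧ k₂ = _ ∧ k₃ = _ := by simpa using hk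
    have h3 : 3 ≤ α := by omega
    have h8 : (2 : ℝ) ^ 3 ≤ 2 ^ α := pow_le_pow_right₀ (by norm_num) h3
    have hl : 0 < Real.log ((2 : ℝ) ^ α - 1) := Real.log_pos (by linarith)
    have hα0 : (α : ℝ) ≠ 0 := by positivity
    have hm1 : 1 ≤ m₃ := by
      rw [hm₃, one_le_div hl, ← Real.log_pow]
      exact Real.log_le_log (by linarith) (by linarith)
    have hv : 0 ≤ Real.log va / (va - 1) := by
      set t := 3 * (α : ℝ) * Real.log 2 with ht_def
      have ht : 2 < t := by
        have := mul_le_mul_of_nonneg_right hα' (show 0 ≤ Real.log 2 by linarith)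
        linarith
      have h4 : Real.log t ≤ Real.log 2 + (t / 2 - 1) := by
        have h5 := Real.log_le_sub_one_of_pos (show 0 < t / 2 by linarith)
        rw [Real.log_div (by linarith) (by norm_num)] at h5
        linarith
      have hva1 : 1 ≤ va := by linarith
      exact div_nonneg (Real.log_nonneg hva1) (by linarith)
    have hv2 : 1 ≤ (1 + Real.log va / (va - 1)) ^ 2 := one_le_pow₀ (by linarith)
    refine ⟨m₃, hm1, ?_, hlb, ?_, fun h => absurd h h2, ?_, ?_⟩
    · rw [hm₃, div_mul_eq_mul_div, le_div_iff₀ hl]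
      refine mul_le_mul_of_nonneg_left (Real.log_le_log (by linarith) ?_) (by positivity)
      have : (2 : ℝ) ^ α ≤ a + 1 := by exact_mod_cast hle
      linarith
    · have : 2705 * m₃ / (α * β) * α * β = 2705 * m₃ := by field_simp
      linarith
    · have h4 : 156.39 * m₃ * (1 + Real.log va / (va - 1)) ^ 2 / ((α : ℝ) ^ 3 * β) * α ^ 3 * β =
          156.39 * m₃ * (1 + Real.log va / (va - 1)) ^ 2 := by
        field_simp
      rw [h4]
      calc 12.505 ^ 2 * m₃ ≤ 156.39 * m₃ * 1 := by linarith
        _ ≤ _ := by gcongr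
    · gcongr
      norm_num

theorem miyazaki_pink_lemma1
    (a b c : ℕ) (ha : 1 < a) (hb : 1 < b) (hc : 1 < c)
    (haodd : Odd a) (hbodd : Odd b) (hceven : Even c)
    (hab : Nat.Coprime a b) (hmax : 9 ≤ max a b)
    (α β : ℕ)
    (hα : α = min (padicValNat 2 (a ^ 2 - 1) - 1) (padicValNat 2 (b ^ 2 - 1) - 1))
    (hβ : β = padicValNat 2 c)
    (m₂ m₃ va k₁ k₂ k₃ : ℝ)
    (hm₂ : m₂ = if 7 < min a b then 1 else Real.log 8 / Real.log (min a b))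
    (hm₃ : m₃ = (α : ℝ) * Real.log 2 / Real.log ((2 : ℝ) ^ α - 1))
    (hva : va = 3 * (α : ℝ) * Real.log 2 - Real.log (3 * (α : ℝ) * Real.log 2))
    (hk : if α = 2 then
            (k₁, k₂, k₃) = (1803.3 * m₂ / β, 23.865 * m₂ / β, 143.75 * (m₂ + 1) / β)
          else
            (k₁, k₂, k₃) = (2705 * m₃ / (α * β),
              156.39 * m₃ * (1 + Real.log va / (va - 1)) ^ 2 / ((α : ℝ) ^ 3 * β),
              646.9 * (m₃ + 1) / ((α : ℝ) ^ 2 * β))) :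
    ∀ x y z : ℕ, 0 < x → 0 < y → 1 < z → a ^ x + b ^ y = c ^ z →
      (z : ℝ) < Real.log a * Real.log b *
        max k₁ (k₂ * (max 1 (Real.log (k₃ * Real.log c))) ^ 2) := by
  have hα2 : 2 ≤ α := by
    have h1 := three_le_padicValNat_sq_sub_one ha haodd
    have h2 := three_le_padicValNat_sq_sub_one hb hbodd
    omega
  have hβ0 : 0 < β := by
    rw [hβ]
    exact one_le_padicValNat_of_dvd (by omega) hceven.two_dvd
  have hcβ : 2 ^ β ∣ c := hβ ▸ pow_padicValNat_dvd
  have hdvd : ∀ {n : ℕ}, 1 < n → α + 1 ≤ padicValNat 2 (n ^ 2 - 1) →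
      2 ^ (α + 1) ∣ (n : ℤ) ^ 2 - 1 := by
    intro n hn h
    have h1 : 1 < n ^ 2 := Nat.one_lt_pow two_ne_zero hn
    have h2 := (padicValNat_dvd_iff_le (Nat.sub_pos_of_lt h1).ne').2 h
    have h3 : ((2 ^ (α + 1) : ℕ) : ℤ) ∣ ((n ^ 2 - 1 : ℕ) : ℤ) := Int.natCast_dvd_natCast.2 h2
    rw [Nat.cast_sub h1.le] at h3
    exact_mod_cast h3
  have haα := hdvd ha (by omega)
  have hbα := hdvd hb (by omega)
  intro x y z hx hy hz h
  rcases lt_trichotomy a b with hlt | rfl | hlt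
  · rw [min_eq_left hlt.le, min_eq_left (by exact_mod_cast hlt.le)] at hm₂
    obtain ⟨m, hm, hA, hB, h₁, h₁', h₂, h₃⟩ :=
      admissible_constants ha hlt hα2 hβ0 haodd haα hm₂ hm₃ hva hk
    exact lt_of_pow_add_pow_eq_pow ha hb hc haodd hbodd hab hα2 hβ0 haα hbα hcβ hm hA hB
      h₁ h₁' h₂ h₃ hx hz h
  · rw [Nat.coprime_self] at hab
    omega
  · rw [min_eq_right hlt.le, min_eq_right (by exact_mod_cast hlt.le)] at hm₂
    obtain ⟨m, hm, hA, hB, h₁, h₁', h₂, h₃⟩ :=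
      admissible_constants hb hlt hα2 hβ0 hbodd hbα hm₂ hm₃ hva hk
    rw [mul_comm (Real.log a)]
    exact lt_of_pow_add_pow_eq_pow hb ha hc hbodd haodd hab.symm hα2 hβ0 hbα haα hcβ hm hA hB
      h₁ h₁' h₂ h₃ hy hz (by rw [add_comm, h])
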